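/- arXiv:1210.1070 — 2 statements merged into one kernel-verified Lean document; each statement's English description precedes it below -/
import Mathlib

section
/- Let v be a positive solution on the half-space H. Then there exist constants 0 < C₁ ≤ C₂ such that C₁ z₁ ≤ v(z) ≤ C₂ z₁ for all z ∈ H; in particular v(z) = O(z₁) as z₁ → +∞ uniformly with respect to the remaining coordinates. -/
open MeasureTheory Filter Set Metric

noncomputable section

/-- The Laplacian on `ℝ^N` (as `EuclideanSpace`): sum of the pure second partial
derivatives. -/
def lapE {d : ℕ} (u : EuclideanSpace ℝ (Fin (d+2)) → ℝ) (z : EuclideanSpace ℝ (Fin (d+2))) : ℝ :=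
  ∑ i : Fin (d+2), fderiv ℝ (fun z' => fderiv ℝ u z' (EuclideanSpace.single i 1)) z
    (EuclideanSpace.single i 1)

/-- `|∇u|²`, the squared norm of the gradient. -/
def gradSqE {d : ℕ} (u : EuclideanSpace ℝ (Fin (d+2)) → ℝ) (z : EuclideanSpace ℝ (Fin (d+2))) : ℝ :=
  ∑ i : Fin (d+2), (fderiv ℝ u z (EuclideanSpace.single i 1))^2

/-- The open half-space `H = {z ∈ ℝ^N : z₁ > 0}`. -/
def HalfSpace (d : ℕ) : Set (EuclideanSpace ℝ (Fin (d+2))) :=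
  {z | 0 < z 0}

/-- A positive solution on the half-space `H`: continuous on the closure of `H`, twice
continuously differentiable and harmonic in `H`, positive in `H`, vanishing on `{z₁ = 0}`. -/
def IsPosSolHS {d : ℕ} (v : EuclideanSpace ℝ (Fin (d+2)) → ℝ) : Prop :=
  ContinuousOn v (closure (HalfSpace d)) ∧
  ContDiffOn ℝ 2 v (HalfSpace d) ∧
  (∀ z ∈ HalfSpace d, lapE v z = 0) ∧
  (∀ z ∈ HalfSpace d, 0 < v z) ∧
  (∀ z : EuclideanSpace ℝ (Fin (d+2)), z 0 = 0 → v z = 0)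

/-- The ambient Euclidean space `ℝ^(d+2)`. -/
abbrev Euc (d : ℕ) := EuclideanSpace ℝ (Fin (d + 2))

/-- The radial weight `(1 - |y|²)₊`. -/
def radialWeight {d : ℕ} (y : Euc d) : ℝ := max (1 - ‖y‖ ^ 2) 0

lemma radialWeight_nonneg {d : ℕ} (y : Euc d) : 0 ≤ radialWeight y := le_max_right _ _

lemma continuous_radialWeight {d : ℕ} : Continuous (radialWeight (d := d)) := by
  unfold radialWeight
  fun_prop

lemma radialWeight_eq_zero {d : ℕ} {y : Euc d} (hy : 1 ≤ ‖y‖) : radialWeight y = 0 :=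
  max_eq_right (by nlinarith)

lemma norm_le_one_of_radialWeight_ne_zero {d : ℕ} {y : Euc d} (hy : radialWeight y ≠ 0) :
    ‖y‖ ≤ 1 := by
  by_contra! h
  exact hy (radialWeight_eq_zero h.le)

lemma hasCompactSupport_radialWeight {d : ℕ} : HasCompactSupport (radialWeight (d := d)) := by
  refine HasCompactSupport.intro (isCompact_closedBall (0 : Euc d) 1) fun y hy => ?_
  rw [mem_closedBall_zero_iff, not_le] at hy
  exact radialWeight_eq_zero hy.le

lemma integrable_mul_radialWeight {d : ℕ} {f : Euc d → ℝ} (hf : Continuous f) :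
    Integrable (fun y => f y * radialWeight y) :=
  (hf.mul continuous_radialWeight).integrable_of_hasCompactSupport
    hasCompactSupport_radialWeight.mul_left

lemma integral_radialWeight_pos {d : ℕ} : 0 < ∫ y : Euc d, radialWeight y :=
  continuous_radialWeight.integral_pos_of_hasCompactSupport_nonneg_nonzero
    hasCompactSupport_radialWeight radialWeight_nonneg (x := 0) (by simp [radialWeight])

lemma hasDerivAt_max_zero_sq (t : ℝ) :
    HasDerivAt (fun s : ℝ => (max s 0) ^ 2) (2 * max t 0) t := by
  rcases lt_trichotomy t 0 with ht | rfl | ht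
  · rw [max_eq_right ht.le, mul_zero]
    refine (hasDerivAt_const t (0 : ℝ)).congr_of_eventuallyEq ?_
    filter_upwards [Iio_mem_nhds ht] with s hs
    rw [max_eq_right (le_of_lt hs)]
    simp
  · simp only [max_self, mul_zero]
    rw [hasDerivAt_iff_isLittleO_nhds_zero]
    have h : (fun h : ℝ => h ^ 2) =o[nhds 0] fun h : ℝ => h := by
      simpa using Asymptotics.isLittleO_pow_pow (𝕜 := ℝ) one_lt_two
    refine (Asymptotics.IsBigO.of_bound 1 (Eventually.of_forall fun s => ?_)).trans_isLittleO h
    rcases le_total s 0 with hs | hs <;> simp [hs, sq_nonneg]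
  · rw [max_eq_left ht.le]
    have : HasDerivAt (fun s : ℝ => s ^ 2) (2 * t) t := by simpa using hasDerivAt_pow 2 t
    refine this.congr_of_eventuallyEq ?_
    filter_upwards [Ioi_mem_nhds ht] with s hs
    rw [max_eq_left (le_of_lt hs)]

lemma hasFDerivAt_radialWeight_sq {d : ℕ} (y : Euc d) :
    HasFDerivAt (fun y : Euc d => radialWeight y ^ 2) ((-4 * radialWeight y) • innerSL ℝ y) y := by
  have h1 : HasFDerivAt (fun y : Euc d => 1 - ‖y‖ ^ 2) (-(2 • innerSL ℝ y)) y :=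
    (hasStrictFDerivAt_norm_sq y).hasFDerivAt.const_sub 1
  have h2 := (hasDerivAt_max_zero_sq (1 - ‖y‖ ^ 2)).comp_hasFDerivAt y h1
  refine h2.congr_fderiv ?_
  ext w
  simp only [_root_.smul_apply, _root_.neg_apply, smul_eq_mul, nsmul_eq_mul, radialWeight]
  push_cast
  ring

lemma fderiv_radialWeight_sq_single {d : ℕ} (y : Euc d) (i : Fin (d + 2)) :
    fderiv ℝ (fun y : Euc d => radialWeight y ^ 2) y (EuclideanSpace.single i 1) =
      -4 * (radialWeight y * y i) := by
  rw [(hasFDerivAt_radialWeight_sq y).fderiv]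
  simp [EuclideanSpace.inner_single_right]
  ring

lemma contDiff_fderiv_single {d : ℕ} {U : Euc d → ℝ} (hU : ContDiff ℝ 2 U) (i : Fin (d + 2)) :
    ContDiff ℝ 1 (fun z => fderiv ℝ U z (EuclideanSpace.single i 1)) :=
  (hU.fderiv_right (m := 1) (by norm_num)).clm_apply contDiff_const

lemma continuous_lapE {d : ℕ} {U : Euc d → ℝ} (hU : ContDiff ℝ 2 U) : Continuous (lapE U) := by
  unfold lapE
  refine continuous_finsetSum _ fun i _ => ?_
  exact ((contDiff_fderiv_single hU i).continuous_fderiv (by norm_num)).clm_apply continuous_const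

lemma integral_fderiv_mul_coord_radialWeight {d : ℕ} {f : Euc d → ℝ} (hf : ContDiff ℝ 1 f)
    (x : Euc d) (r : ℝ) (i : Fin (d + 2)) :
    ∫ y, f (x + r • y) * (radialWeight y * y i) =
      r / 4 * ∫ y, fderiv ℝ f (x + r • y) (EuclideanSpace.single i 1) * radialWeight y ^ 2 := by
  have hdf : ∀ y, fderiv ℝ (fun y => f (x + r • y)) y (EuclideanSpace.single i 1) =
      r * fderiv ℝ f (x + r • y) (EuclideanSpace.single i 1) := by
    intro y
    have h1 : HasFDerivAt (fun y : Euc d => x + r • y) (r • ContinuousLinearMap.id ℝ (Euc d)) y :=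
      ((hasFDerivAt_id y).const_smul r).const_add x
    have h2 := ((hf.differentiable (by norm_num)) (x + r • y)).hasFDerivAt.comp y h1
    rw [show (fun y => f (x + r • y)) = f ∘ fun y => x + r • y from rfl, h2.fderiv]
    simp
  have hcf : Continuous fun y : Euc d => f (x + r • y) := hf.continuous.comp (by fun_prop)
  have hcf' : Continuous fun y : Euc d =>
      fderiv ℝ f (x + r • y) (EuclideanSpace.single i 1) :=
    ((hf.continuous_fderiv (by norm_num)).clm_apply continuous_const).comp
      (show Continuous fun y : Euc d => x + r • y by fun_prop)
  have hci : Continuous fun y : Euc d => y i := by fun_prop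
  have hw := continuous_radialWeight (d := d)
  have key := integral_mul_fderiv_eq_neg_fderiv_mul_of_integrable
    (μ := (volume : Measure (Euc d))) (f := fun y => f (x + r • y))
    (g := fun y => radialWeight y ^ 2) (v := EuclideanSpace.single i (1 : ℝ)) ?_ ?_ ?_ ?_ ?_
  · simp only [fderiv_radialWeight_sq_single, hdf] at key
    have e1 : ∫ y, f (x + r • y) * (-4 * (radialWeight y * y i)) =
        -4 * ∫ y, f (x + r • y) * (radialWeight y * y i) := by
      rw [← integral_const_mul]
      exact integral_congr_ae (Eventually.of_forall fun y => by ring)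
    have e2 : ∫ y, r * fderiv ℝ f (x + r • y) (EuclideanSpace.single i 1) * radialWeight y ^ 2 =
        r * ∫ y, fderiv ℝ f (x + r • y) (EuclideanSpace.single i 1) * radialWeight y ^ 2 := by
      rw [← integral_const_mul]
      exact integral_congr_ae (Eventually.of_forall fun y => by ring)
    rw [e1, e2] at key
    linarith
  · simp only [hdf]
    refine (integrable_mul_radialWeight (((continuous_const (y := r)).mul hcf').mul hw)).congr
      (Eventually.of_forall fun y => ?_)
    simp only [Pi.mul_apply]
    ring
  · simp only [fderiv_radialWeight_sq_single]
    refine (integrable_mul_radialWeight ((continuous_const (y := (-4 : ℝ))).mul (hcf.mul hci))).congr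
      (Eventually.of_forall fun y => ?_)
    simp only [Pi.mul_apply]
    ring
  · refine (integrable_mul_radialWeight (hcf.mul hw)).congr (Eventually.of_forall fun y => ?_)
    simp only [Pi.mul_apply]
    ring
  · intro y _
    exact (hf.differentiable (by norm_num) _).comp y (by fun_prop)
  · exact fun y _ => (hasFDerivAt_radialWeight_sq y).differentiableAt

lemma integral_fderiv_apply_radialWeight {d : ℕ} {U : Euc d → ℝ} (hU : ContDiff ℝ 2 U)
    (x : Euc d) (r : ℝ) :
    ∫ y, fderiv ℝ U (x + r • y) y * radialWeight y =
      r / 4 * ∫ y, lapE U (x + r • y) * radialWeight y ^ 2 := by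
  have hshift : Continuous fun y : Euc d => x + r • y := by fun_prop
  have hw := continuous_radialWeight (d := d)
  have h1 : ∀ y : Euc d, fderiv ℝ U (x + r • y) y * radialWeight y =
      ∑ i, fderiv ℝ U (x + r • y) (EuclideanSpace.single i 1) * (radialWeight y * y i) := by
    intro y
    have hy : y = ∑ i, y i • EuclideanSpace.single i (1 : ℝ) := by
      simpa using ((EuclideanSpace.basisFun (Fin (d + 2)) ℝ).sum_repr y).symm
    conv_lhs => rw [show fderiv ℝ U (x + r • y) y =
      fderiv ℝ U (x + r • y) (∑ i, y i • EuclideanSpace.single i (1 : ℝ)) by rw [← hy]]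
    rw [map_sum, Finset.sum_mul]
    refine Finset.sum_congr rfl fun i _ => ?_
    rw [map_smul, smul_eq_mul]
    ring
  simp only [h1, lapE, Finset.sum_mul]
  rw [integral_finsetSum, integral_finsetSum, Finset.mul_sum]
  · exact Finset.sum_congr rfl fun i _ =>
      integral_fderiv_mul_coord_radialWeight (contDiff_fderiv_single hU i) x r i
  · intro i _
    refine (integrable_mul_radialWeight
      (((((contDiff_fderiv_single hU i).continuous_fderiv (by norm_num)).clm_apply
        (continuous_const (y := EuclideanSpace.single i (1 : ℝ)))).comp hshift).mul hw)).congr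
      (Eventually.of_forall fun y => ?_)
    simp only [Pi.mul_apply, Function.comp]
    ring
  · intro i _
    refine (integrable_mul_radialWeight
      (((contDiff_fderiv_single hU i).continuous.comp hshift).mul
        (show Continuous fun y : Euc d => y i by fun_prop))).congr
      (Eventually.of_forall fun y => ?_)
    simp only [Pi.mul_apply, Function.comp]
    ring

lemma hasDerivAt_integral_radialWeight {d : ℕ} {U : Euc d → ℝ} (hU : ContDiff ℝ 2 U)
    (x : Euc d) (r : ℝ) :
    HasDerivAt (fun r : ℝ => ∫ y, U (x + r • y) * radialWeight y)
      (r / 4 * ∫ y, lapE U (x + r • y) * radialWeight y ^ 2) r := by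
  rw [← integral_fderiv_apply_radialWeight hU]
  have hU' : Continuous (fderiv ℝ U) := hU.continuous_fderiv (by norm_num)
  obtain ⟨C, hC⟩ := (isCompact_closedBall x (|r| + 1)).exists_bound_of_continuousOn hU'.continuousOn
  have hshift : ∀ s : ℝ, Continuous fun y : Euc d => x + s • y := fun s => by fun_prop
  refine (hasDerivAt_integral_of_dominated_loc_of_deriv_le (bound := fun y => C * radialWeight y)
    (F' := fun s y => fderiv ℝ U (x + s • y) y * radialWeight y) (ball_mem_nhds r one_pos)
    (Eventually.of_forall fun s => ?_) ?_ ?_ (Eventually.of_forall fun y s hs => ?_) ?_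
    (Eventually.of_forall fun y s hs => ?_)).2
  · exact (integrable_mul_radialWeight (hU.continuous.comp (hshift s))).aestronglyMeasurable
  · exact integrable_mul_radialWeight (hU.continuous.comp (hshift r))
  · exact (integrable_mul_radialWeight
      ((hU'.comp (hshift r)).clm_apply continuous_id)).aestronglyMeasurable
  · rw [norm_mul, Real.norm_of_nonneg (radialWeight_nonneg y)]
    by_cases hy : radialWeight y = 0
    · simp [hy]
    have hy1 := norm_le_one_of_radialWeight_ne_zero hy
    refine mul_le_mul_of_nonneg_right ?_ (radialWeight_nonneg y)
    have hs' : |s| ≤ |r| + 1 := by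
      rw [mem_ball, Real.dist_eq] at hs
      have := abs_sub_abs_le_abs_sub s r
      linarith
    have hb : ‖fderiv ℝ U (x + s • y)‖ ≤ C := by
      refine hC _ ?_
      rw [mem_closedBall, dist_eq_norm, add_sub_cancel_left, norm_smul, Real.norm_eq_abs]
      nlinarith [abs_nonneg s, norm_nonneg y]
    calc ‖fderiv ℝ U (x + s • y) y‖ ≤ ‖fderiv ℝ U (x + s • y)‖ * ‖y‖ :=
          ContinuousLinearMap.le_opNorm _ _
      _ ≤ ‖fderiv ℝ U (x + s • y)‖ * 1 := by gcongr
      _ ≤ C := by linarith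
  · exact integrable_mul_radialWeight continuous_const
  · have h1 : HasDerivAt (fun s : ℝ => x + s • y) y s := by
      simpa using ((hasDerivAt_id s).smul_const y).const_add x
    exact (((hU.differentiable (by norm_num)) (x + s • y)).hasFDerivAt.comp_hasDerivAt s
      h1).mul_const _

/-- The unnormalised paraboloid kernel `(r² - |z - x|²)₊`. -/
def capKernel {d : ℕ} (r : ℝ) (x z : Euc d) : ℝ := max (r ^ 2 - ‖z - x‖ ^ 2) 0

lemma capKernel_nonneg {d : ℕ} (r : ℝ) (x z : Euc d) : 0 ≤ capKernel r x z := le_max_right _ _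

lemma continuous_capKernel {d : ℕ} (r : ℝ) (x : Euc d) : Continuous (capKernel r x) := by
  unfold capKernel
  fun_prop

lemma capKernel_eq_zero {d : ℕ} {r : ℝ} (hr : 0 ≤ r) {x z : Euc d} (h : r ≤ ‖z - x‖) :
    capKernel r x z = 0 :=
  max_eq_right (by nlinarith)

lemma hasCompactSupport_capKernel {d : ℕ} {r : ℝ} (hr : 0 ≤ r) (x : Euc d) :
    HasCompactSupport (capKernel r x) := by
  refine HasCompactSupport.intro (isCompact_closedBall x r) fun z hz => ?_
  rw [mem_closedBall, dist_eq_norm, not_le] at hz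
  exact capKernel_eq_zero hr hz.le

lemma integrable_mul_capKernel {d : ℕ} {f : Euc d → ℝ} (hf : Continuous f) {r : ℝ} (hr : 0 ≤ r)
    (x : Euc d) : Integrable (fun z => f z * capKernel r x z) :=
  (hf.mul (continuous_capKernel r x)).integrable_of_hasCompactSupport
    (hasCompactSupport_capKernel hr x).mul_left

lemma integral_mul_capKernel_pow {d : ℕ} (f : Euc d → ℝ) (x : Euc d) {r : ℝ} (hr : 0 < r)
    (k : ℕ) :
    ∫ z, f z * capKernel r x z ^ k =
      r ^ (d + 2 + 2 * k) * ∫ y, f (x + r • y) * radialWeight y ^ k := by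
  have h1 : ∫ z, f z * capKernel r x z ^ k = ∫ z, f (x + z) * capKernel r x (x + z) ^ k :=
    (integral_add_left_eq_self (fun z => f z * capKernel r x z ^ k) x).symm
  have h2 := Measure.integral_comp_smul_of_nonneg (volume : Measure (Euc d))
    (fun z => f (x + z) * capKernel r x (x + z) ^ k) r (hR := hr.le)
  rw [finrank_euclideanSpace_fin, ← h1, smul_eq_mul] at h2
  have h3 : ∀ y : Euc d, f (x + r • y) * capKernel r x (x + r • y) ^ k =
      r ^ (2 * k) * (f (x + r • y) * radialWeight y ^ k) := by
    intro y
    have : capKernel r x (x + r • y) = r ^ 2 * radialWeight y := by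
      rw [capKernel, radialWeight, add_sub_cancel_left, norm_smul, Real.norm_of_nonneg hr.le,
        mul_max_of_nonneg _ _ (sq_nonneg r)]
      ring_nf
    rw [this, mul_pow, ← pow_mul]
    ring
  simp only [h3] at h2
  rw [integral_const_mul, eq_inv_mul_iff_mul_eq₀ (by positivity)] at h2
  rw [← h2, pow_add]
  ring

/-- Reflection in the hyperplane `{z₁ = 0}`. -/
def mirror (d : ℕ) : Euc d ≃ₗᵢ[ℝ] Euc d :=
  (ℝ ∙ (EuclideanSpace.single 0 1 : Euc d))ᗮ.reflection

lemma mirror_apply {d : ℕ} (x : Euc d) :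
    mirror d x = x - (2 * x 0) • (EuclideanSpace.single 0 1 : Euc d) := by
  rw [mirror, Submodule.reflection_orthogonal_apply, Submodule.reflection_singleton_apply]
  simp [EuclideanSpace.inner_single_left, mul_smul, two_smul]

lemma mirror_apply_zero {d : ℕ} (x : Euc d) : mirror d x 0 = - x 0 := by
  rw [mirror_apply]
  simp
  ring

lemma mirror_mirror {d : ℕ} (x : Euc d) : mirror d (mirror d x) = x :=
  Submodule.reflection_reflection _ x

lemma norm_sub_mirror_sq {d : ℕ} (x z : Euc d) :
    ‖z - mirror d x‖ ^ 2 = ‖z - x‖ ^ 2 + 4 * (z 0 * x 0) := by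
  have : z - mirror d x = (z - x) + (2 * x 0) • (EuclideanSpace.single 0 1 : Euc d) := by
    rw [mirror_apply]
    abel
  rw [this, norm_add_sq_real, inner_smul_right, EuclideanSpace.inner_single_right, norm_smul]
  simp [mul_pow]
  ring

/-- The odd reflection of `capKernel` in the hyperplane `{z₁ = 0}`. -/
def oddKernel {d : ℕ} (r : ℝ) (x z : Euc d) : ℝ := capKernel r x z - capKernel r (mirror d x) z

lemma capKernel_mirror_le {d : ℕ} (r : ℝ) {x z : Euc d} (hx : 0 < x 0) (hz : 0 < z 0) :
    capKernel r (mirror d x) z ≤ capKernel r x z := by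
  unfold capKernel
  rw [norm_sub_mirror_sq]
  exact max_le_max_right _ (by nlinarith [mul_pos hx hz])

lemma oddKernel_nonneg {d : ℕ} (r : ℝ) {x z : Euc d} (hx : 0 < x 0) (hz : 0 < z 0) :
    0 ≤ oddKernel r x z :=
  sub_nonneg.2 (capKernel_mirror_le r hx hz)

lemma oddKernel_le {d : ℕ} (r : ℝ) {x z : Euc d} (hx : 0 < x 0) (hz : 0 < z 0) :
    oddKernel r x z ≤ 4 * (z 0 * x 0) := by
  unfold oddKernel capKernel
  rw [norm_sub_mirror_sq]
  have := mul_pos hz hx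
  rw [sub_le_iff_le_add]
  refine max_le ?_ (by positivity)
  have := le_max_left (r ^ 2 - (‖z - x‖ ^ 2 + 4 * (z 0 * x 0))) 0
  linarith

lemma oddKernel_eq {d : ℕ} {r : ℝ} {x z : Euc d} (h : ‖z - x‖ ≤ r) (h' : ‖z - mirror d x‖ ≤ r) :
    oddKernel r x z = 4 * (z 0 * x 0) := by
  unfold oddKernel capKernel
  rw [max_eq_left (by nlinarith [norm_nonneg (z - x)]),
    max_eq_left (by nlinarith [norm_nonneg (z - mirror d x)]), norm_sub_mirror_sq]
  ring

lemma oddKernel_eq_zero {d : ℕ} {r : ℝ} (hr : 0 ≤ r) {x z : Euc d} (hx : 0 < x 0) (hz : 0 < z 0)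
    (h : r ≤ ‖z - x‖) : oddKernel r x z = 0 := by
  refine le_antisymm ?_ (oddKernel_nonneg r hx hz)
  rw [oddKernel, capKernel_eq_zero hr h, zero_sub, neg_nonpos]
  exact capKernel_nonneg _ _ _

lemma continuous_oddKernel {d : ℕ} (r : ℝ) (x : Euc d) : Continuous (oddKernel r x) :=
  (continuous_capKernel r x).sub (continuous_capKernel r _)

lemma lapE_eq_zero_of_notMem_tsupport {d : ℕ} {U : Euc d → ℝ} {z : Euc d} (hz : z ∉ tsupport U) :
    lapE U z = 0 := by
  have hU := notMem_tsupport_iff_eventuallyEq.1 hz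
  refine Finset.sum_eq_zero fun i _ => ?_
  have h : (fun z' => fderiv ℝ U z' (EuclideanSpace.single i 1)) =ᶠ[nhds z] fun _ => 0 := by
    filter_upwards [hU.fderiv (𝕜 := ℝ)] with w hw
    rw [hw]
    simp
  rw [h.fderiv_eq]
  simp

/-- Mean value inequality on the half-space for functions that are subharmonic and supported
away from the boundary. -/
lemma mul_le_integral_mul_oddKernel {d : ℕ} {U : Euc d → ℝ} (hU : ContDiff ℝ 2 U)
    (hsupp : tsupport U ⊆ HalfSpace d) (hlap : ∀ z ∈ HalfSpace d, 0 ≤ lapE U z)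
    {x : Euc d} (hx : x ∈ HalfSpace d) {r : ℝ} (hr : 0 < r) :
    r ^ (d + 4) * (U x * ∫ y : Euc d, radialWeight y) ≤ ∫ z, U z * oddKernel r x z := by
  have hx0 : 0 < x 0 := hx
  set D : ℝ → ℝ := fun s => (∫ y, U (x + s • y) * radialWeight y) -
    ∫ y, U (mirror d x + s • y) * radialWeight y with hD
  have hderiv : ∀ s, HasDerivAt D (s / 4 * (∫ y, lapE U (x + s • y) * radialWeight y ^ 2) -
      s / 4 * ∫ y, lapE U (mirror d x + s • y) * radialWeight y ^ 2) s := fun s =>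
    (hasDerivAt_integral_radialWeight hU x s).sub
      (hasDerivAt_integral_radialWeight hU (mirror d x) s)
  have hmono : MonotoneOn D (Ici 0) := by
    refine monotoneOn_of_deriv_nonneg (convex_Ici 0)
      (fun s _ => (hderiv s).continuousAt.continuousWithinAt)
      (fun s _ => (hderiv s).differentiableAt.differentiableWithinAt) fun s hs => ?_
    rw [interior_Ici] at hs
    have hs0 : 0 < s := hs
    have hlap' : ∀ z, z ∉ HalfSpace d → lapE U z = 0 := fun z hz =>
      lapE_eq_zero_of_notMem_tsupport fun h => hz (hsupp h)
    have hlap0 : ∀ z, 0 ≤ lapE U z := fun z => by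
      by_cases hz : z ∈ HalfSpace d
      · exact hlap z hz
      · exact (hlap' z hz).ge
    have hle : ∫ z, lapE U z * capKernel s (mirror d x) z ^ 2 ≤
        ∫ z, lapE U z * capKernel s x z ^ 2 := by
      refine integral_mono_of_nonneg (Eventually.of_forall fun z => ?_) ?_
        (Eventually.of_forall fun z => ?_)
      · exact mul_nonneg (hlap0 z) (sq_nonneg _)
      · refine (integrable_mul_capKernel ((continuous_lapE hU).mul (continuous_capKernel s x))
          hs0.le x).congr (Eventually.of_forall fun z => ?_)
        simp only [Pi.mul_apply]
        ring
      · by_cases hz : z ∈ HalfSpace d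
        · exact mul_le_mul_of_nonneg_left (pow_le_pow_left₀ (capKernel_nonneg _ _ _)
            (capKernel_mirror_le s hx0 hz) 2) (hlap0 z)
        · simp [hlap' z hz]
    rw [integral_mul_capKernel_pow _ _ hs0, integral_mul_capKernel_pow _ _ hs0] at hle
    have hle' := le_of_mul_le_mul_left hle (by positivity)
    rw [(hderiv s).deriv, ← mul_sub]
    exact mul_nonneg (by positivity) (sub_nonneg.2 hle')
  have h0 : D 0 = U x * ∫ y : Euc d, radialWeight y := by
    have hm : U (mirror d x) = 0 := by
      refine image_eq_zero_of_notMem_tsupport fun h => ?_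
      have h1 : 0 < mirror d x 0 := hsupp h
      rw [mirror_apply_zero] at h1
      linarith
    simp [hD, hm, integral_const_mul]
  have h1 : ∫ z, U z * oddKernel r x z = r ^ (d + 4) * D r := by
    have e1 := integral_mul_capKernel_pow U x hr 1
    have e2 := integral_mul_capKernel_pow U (mirror d x) hr 1
    simp only [pow_one] at e1 e2
    simp only [oddKernel, mul_sub]
    rw [integral_sub (integrable_mul_capKernel hU.continuous hr.le _)
      (integrable_mul_capKernel hU.continuous hr.le _), e1, e2, hD]
    ring
  rw [h1, ← h0]
  exact mul_le_mul_of_nonneg_left (hmono self_mem_Ici hr.le hr.le) (by positivity)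

/-- A smooth convex approximation of the positive part. -/
def smoothPosPart (t : ℝ) : ℝ := ∫ s in (0 : ℝ)..t, Real.smoothTransition s

lemma hasDerivAt_smoothPosPart (t : ℝ) :
    HasDerivAt smoothPosPart (Real.smoothTransition t) t :=
  intervalIntegral.integral_hasDerivAt_right
    (Real.smoothTransition.continuous.intervalIntegrable _ _)
    (Real.smoothTransition.continuous.stronglyMeasurableAtFilter _ _)
    Real.smoothTransition.continuousAt

lemma deriv_smoothPosPart : deriv smoothPosPart = Real.smoothTransition :=
  funext fun t => (hasDerivAt_smoothPosPart t).deriv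

lemma contDiff_smoothPosPart : ContDiff ℝ 2 smoothPosPart := by
  rw [show (2 : WithTop ℕ∞) = 1 + 1 by norm_num, contDiff_succ_iff_deriv]
  refine ⟨fun t => (hasDerivAt_smoothPosPart t).differentiableAt, by simp, ?_⟩
  rw [deriv_smoothPosPart]
  exact Real.smoothTransition.contDiff

lemma smoothPosPart_of_nonpos {t : ℝ} (ht : t ≤ 0) : smoothPosPart t = 0 := by
  rw [smoothPosPart, intervalIntegral.integral_congr (g := fun _ => 0)]
  · simp
  · intro s hs
    rw [uIcc_of_ge ht] at hs
    exact Real.smoothTransition.zero_of_nonpos hs.2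

lemma smoothPosPart_le {t : ℝ} (ht : 0 ≤ t) : smoothPosPart t ≤ t := by
  have := intervalIntegral.integral_mono_on (f := Real.smoothTransition) (g := fun _ => (1 : ℝ))
    (μ := volume) ht
    (Real.smoothTransition.continuous.intervalIntegrable _ _) (by simp)
    (fun s _ => Real.smoothTransition.le_one s)
  simpa [smoothPosPart] using this

lemma sub_one_le_smoothPosPart (t : ℝ) : t - 1 ≤ smoothPosPart t := by
  have hmono : Monotone smoothPosPart := monotone_of_deriv_nonneg
    (fun t => (hasDerivAt_smoothPosPart t).differentiableAt)
    (fun t => by rw [deriv_smoothPosPart]; exact Real.smoothTransition.nonneg t)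
  have h0 : smoothPosPart 0 = 0 := smoothPosPart_of_nonpos le_rfl
  rcases le_total t 1 with ht | ht
  · rcases le_total t 0 with h | h
    · rw [smoothPosPart_of_nonpos h]
      linarith
    · linarith [hmono h]
  · have h1 : smoothPosPart t = smoothPosPart 1 + ∫ s in (1 : ℝ)..t, Real.smoothTransition s :=
      (intervalIntegral.integral_add_adjacent_intervals
        (Real.smoothTransition.continuous.intervalIntegrable _ _)
        (Real.smoothTransition.continuous.intervalIntegrable _ _)).symm
    have h2 : ∫ s in (1 : ℝ)..t, Real.smoothTransition s = t - 1 := by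
      rw [intervalIntegral.integral_congr (g := fun _ => 1)]
      · simp
      · intro s hs
        rw [uIcc_of_le ht] at hs
        exact Real.smoothTransition.one_of_one_le hs.1
    linarith [hmono (zero_le_one' ℝ)]

lemma lapE_comp {d : ℕ} {φ : ℝ → ℝ} {g : Euc d → ℝ} {z : Euc d} (hφ : ContDiff ℝ 2 φ)
    (hg : ContDiffAt ℝ 2 g z) :
    lapE (fun w => φ (g w)) z =
      deriv (deriv φ) (g z) * gradSqE g z + deriv φ (g z) * lapE g z := by
  unfold lapE gradSqE
  rw [Finset.mul_sum, Finset.mul_sum, ← Finset.sum_add_distrib]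
  refine Finset.sum_congr rfl fun i _ => ?_
  have hev : ∀ᶠ w in nhds z, ContDiffAt ℝ 2 g w := hg.eventually (by simp)
  have h1 : (fun w => fderiv ℝ (fun w => φ (g w)) w (EuclideanSpace.single i 1)) =ᶠ[nhds z]
      fun w => deriv φ (g w) * fderiv ℝ g w (EuclideanSpace.single i 1) := by
    filter_upwards [hev] with w hw
    have := ((hφ.differentiable (by norm_num)) (g w)).hasDerivAt.comp_hasFDerivAt w
      (hw.differentiableAt (by norm_num)).hasFDerivAt
    rw [show (fun w => φ (g w)) = φ ∘ g from rfl, this.fderiv]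
    simp
  rw [h1.fderiv_eq]
  have hφ' : ContDiff ℝ 1 (deriv φ) := by
    have : ContDiff ℝ (1 + 1) φ := by norm_num; exact hφ
    exact (contDiff_succ_iff_deriv.1 this).2.2
  have h2 := ((hφ'.differentiable (by norm_num)) (g z)).hasDerivAt.comp_hasFDerivAt z
      (hg.differentiableAt (by norm_num)).hasFDerivAt
  have h3 : DifferentiableAt ℝ (fun w => fderiv ℝ g w (EuclideanSpace.single i 1)) z :=
    ((hg.fderiv_right (m := 1) (by norm_num)).clm_apply contDiffAt_const).differentiableAt
      (by norm_num)
  have h4 := h2.mul h3.hasFDerivAt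
  have h5 : (fun w => deriv φ (g w) * fderiv ℝ g w (EuclideanSpace.single i 1)) =
    (deriv φ ∘ g) * fun w => fderiv ℝ g w (EuclideanSpace.single i 1) := rfl
  rw [h5, h4.fderiv]
  simp
  ring

lemma isOpen_halfSpace (d : ℕ) : IsOpen (HalfSpace d) :=
  isOpen_lt continuous_const (by fun_prop)

lemma nonneg_of_mem_closure_halfSpace {d : ℕ} {z : Euc d} (hz : z ∈ closure (HalfSpace d)) :
    0 ≤ z 0 :=
  closure_minimal (s := HalfSpace d) (t := {w : Euc d | 0 ≤ w 0}) (fun w (hw : 0 < w 0) => show 0 ≤ w 0 from hw.le)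
    (isClosed_le continuous_const (by fun_prop)) hz

open Classical in
/-- A smooth subharmonic truncation of a function on the half-space, extended by zero. -/
def truncation {d : ℕ} (ε : ℝ) (g : Euc d → ℝ) (z : Euc d) : ℝ :=
  if z ∈ HalfSpace d then ε * smoothPosPart (g z / ε - 1) else 0

lemma truncation_of_mem {d : ℕ} (ε : ℝ) (g : Euc d → ℝ) {z : Euc d} (hz : z ∈ HalfSpace d) :
    truncation ε g z = ε * smoothPosPart (g z / ε - 1) := if_pos hz

lemma truncation_of_notMem {d : ℕ} (ε : ℝ) (g : Euc d → ℝ) {z : Euc d} (hz : z ∉ HalfSpace d) :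
    truncation ε g z = 0 := if_neg hz

lemma truncation_eq_zero {d : ℕ} {ε : ℝ} (hε : 0 < ε) {g : Euc d → ℝ} {z : Euc d}
    (hz : g z ≤ ε) : truncation ε g z = 0 := by
  by_cases h : z ∈ HalfSpace d
  · rw [truncation_of_mem ε g h, smoothPosPart_of_nonpos, mul_zero]
    rw [sub_nonpos, div_le_one hε]
    exact hz
  · exact truncation_of_notMem ε g h

lemma truncation_le {d : ℕ} {ε : ℝ} (hε : 0 < ε) (g : Euc d → ℝ) (z : Euc d) :
    truncation ε g z ≤ max (g z) 0 := by
  rcases le_total (g z) ε with h | h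
  · rw [truncation_eq_zero hε h]
    exact le_max_right _ _
  · by_cases hz : z ∈ HalfSpace d
    · rw [truncation_of_mem ε g hz]
      refine le_trans ?_ (le_max_left _ _)
      have h1 : 0 ≤ g z / ε - 1 := sub_nonneg.2 ((one_le_div hε).2 h)
      calc ε * smoothPosPart (g z / ε - 1) ≤ ε * (g z / ε - 1) := by
            gcongr
            exact smoothPosPart_le h1
        _ = g z - ε := by field_simp
        _ ≤ g z := by linarith
    · rw [truncation_of_notMem ε g hz]
      exact le_max_right _ _

lemma sub_le_truncation {d : ℕ} {ε : ℝ} (hε : 0 < ε) (g : Euc d → ℝ) {z : Euc d}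
    (hz : z ∈ HalfSpace d) : g z - 2 * ε ≤ truncation ε g z := by
  rw [truncation_of_mem ε g hz]
  calc g z - 2 * ε = ε * (g z / ε - 1 - 1) := by field_simp; ring
    _ ≤ _ := by
      gcongr
      exact sub_one_le_smoothPosPart _

lemma tsupport_truncation_subset {d : ℕ} {ε : ℝ} (hε : 0 < ε) {g : Euc d → ℝ}
    (hc : ContinuousOn g (closure (HalfSpace d)))
    (hb : ∀ z : Euc d, z 0 = 0 → g z ≤ 0) :
    tsupport (truncation ε g) ⊆ HalfSpace d := by
  intro z hz
  by_contra hzH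
  refine notMem_tsupport_iff_eventuallyEq.2 ?_ hz
  by_cases hcl : z ∈ closure (HalfSpace d)
  · have h0 : z 0 = 0 :=
      le_antisymm (not_lt.1 hzH) (nonneg_of_mem_closure_halfSpace hcl)
    have hlt : ∀ᶠ w in nhdsWithin z (closure (HalfSpace d)), g w < ε :=
      (hc z hcl).eventually_lt_const ((hb z h0).trans_lt hε)
    filter_upwards [eventually_nhdsWithin_iff.1 hlt] with w hw
    by_cases hwH : w ∈ HalfSpace d
    · exact truncation_eq_zero hε (hw (subset_closure hwH)).le
    · exact truncation_of_notMem ε g hwH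
  · filter_upwards [isClosed_closure.isOpen_compl.mem_nhds hcl] with w hw
    exact truncation_of_notMem ε g fun h => hw (subset_closure h)

lemma truncation_eventuallyEq {d : ℕ} (ε : ℝ) (g : Euc d → ℝ) {z : Euc d}
    (hz : z ∈ HalfSpace d) :
    truncation ε g =ᶠ[nhds z] fun w => ε * smoothPosPart (g w / ε - 1) := by
  filter_upwards [(isOpen_halfSpace d).mem_nhds hz] with w hw
  exact truncation_of_mem ε g hw

lemma contDiff_scaled_smoothPosPart (ε : ℝ) :
    ContDiff ℝ 2 (fun t => ε * smoothPosPart (t / ε - 1)) :=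
  contDiff_const.mul (contDiff_smoothPosPart.comp
    ((contDiff_id.div_const ε).sub contDiff_const))

lemma contDiff_truncation {d : ℕ} {ε : ℝ} (hε : 0 < ε) {g : Euc d → ℝ}
    (hc : ContinuousOn g (closure (HalfSpace d))) (hg : ContDiffOn ℝ 2 g (HalfSpace d))
    (hb : ∀ z : Euc d, z 0 = 0 → g z ≤ 0) :
    ContDiff ℝ 2 (truncation ε g) := by
  refine contDiff_iff_contDiffAt.2 fun z => ?_
  by_cases hz : z ∈ tsupport (truncation ε g)
  swap
  · exact contDiffAt_const.congr_of_eventuallyEq (notMem_tsupport_iff_eventuallyEq.1 hz)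
  have hzH := tsupport_truncation_subset hε hc hb hz
  refine ContDiffAt.congr_of_eventuallyEq ?_ (truncation_eventuallyEq ε g hzH)
  exact (contDiff_scaled_smoothPosPart ε).contDiffAt.comp z
    (hg.contDiffAt ((isOpen_halfSpace d).mem_nhds hzH))

lemma lapE_congr {d : ℕ} {u w : Euc d → ℝ} {z : Euc d} (h : u =ᶠ[nhds z] w) :
    lapE u z = lapE w z := by
  refine Finset.sum_congr rfl fun i _ => ?_
  have h' : (fun z' => fderiv ℝ u z' (EuclideanSpace.single i 1)) =ᶠ[nhds z]
      fun z' => fderiv ℝ w z' (EuclideanSpace.single i 1) := by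
    filter_upwards [h.fderiv (𝕜 := ℝ)] with y hy
    rw [hy]
  rw [h'.fderiv_eq]

lemma lapE_truncation_nonneg {d : ℕ} {ε : ℝ} (hε : 0 < ε) {g : Euc d → ℝ}
    (hg : ContDiffOn ℝ 2 g (HalfSpace d)) (hlap : ∀ z ∈ HalfSpace d, lapE g z = 0)
    {z : Euc d} (hz : z ∈ HalfSpace d) : 0 ≤ lapE (truncation ε g) z := by
  rw [lapE_congr (truncation_eventuallyEq ε g hz),
    lapE_comp (φ := fun t => ε * smoothPosPart (t / ε - 1)) (contDiff_scaled_smoothPosPart ε)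
      (hg.contDiffAt ((isOpen_halfSpace d).mem_nhds hz)), hlap z hz, mul_zero, add_zero]
  have hd : deriv (fun t => ε * smoothPosPart (t / ε - 1)) =
      fun t => Real.smoothTransition (t / ε - 1) := by
    funext t
    have h1 : HasDerivAt (fun t : ℝ => t / ε - 1) (1 / ε) t :=
      ((hasDerivAt_id t).div_const ε).sub_const 1
    have h2 := ((hasDerivAt_smoothPosPart (t / ε - 1)).comp t h1).const_mul ε
    refine h2.deriv.trans ?_
    field_simp
  have hm : Monotone fun t => Real.smoothTransition (t / ε - 1) := by
    intro s t hst
    refine Real.smoothTransition.monotone ?_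
    gcongr
  rw [hd]
  exact mul_nonneg hm.deriv_nonneg (Finset.sum_nonneg fun i _ => sq_nonneg _)

lemma integrableOn_mul_oddKernel {d : ℕ} {f : Euc d → ℝ}
    (hf : ContinuousOn f (closure (HalfSpace d))) {r : ℝ} (hr : 0 ≤ r) {x : Euc d}
    (hx : x ∈ HalfSpace d) : IntegrableOn (fun z => f z * oddKernel r x z) (HalfSpace d) := by
  have hK : IsCompact (closure (HalfSpace d) ∩ closedBall x r) :=
    (isCompact_closedBall x r).inter_left isClosed_closure
  have h1 : IntegrableOn (fun z => f z * oddKernel r x z)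
      (closure (HalfSpace d) ∩ closedBall x r) :=
    ((hf.mono inter_subset_left).mul
      (continuous_oddKernel r x).continuousOn).integrableOn_compact hK
  have h2 : IntegrableOn (fun z => f z * oddKernel r x z) (HalfSpace d ∩ closedBall x r) :=
    h1.mono_set (inter_subset_inter_left _ subset_closure)
  refine h2.of_forall_sdiff_eq_zero (isOpen_halfSpace d).measurableSet fun z hz => ?_
  have hz' : r ≤ ‖z - x‖ := by
    by_contra! h
    exact hz.2 ⟨hz.1, by rw [mem_closedBall, dist_eq_norm]; exact h.le⟩
  rw [oddKernel_eq_zero hr hx hz.1 hz', mul_zero]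

/-- Mean value inequality for the positive part of a harmonic function on the half-space that
is nonpositive on the boundary. -/
lemma mul_le_setIntegral_posPart_mul_oddKernel {d : ℕ} {g : Euc d → ℝ}
    (hc : ContinuousOn g (closure (HalfSpace d))) (hg : ContDiffOn ℝ 2 g (HalfSpace d))
    (hlap : ∀ z ∈ HalfSpace d, lapE g z = 0) (hb : ∀ z : Euc d, z 0 = 0 → g z ≤ 0)
    {x : Euc d} (hx : x ∈ HalfSpace d) {r : ℝ} (hr : 0 < r) :
    r ^ (d + 4) * (g x * ∫ y : Euc d, radialWeight y) ≤
      ∫ z in HalfSpace d, max (g z) 0 * oddKernel r x z := by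
  set c := ∫ y : Euc d, radialWeight y with hcdef
  have hc0 : 0 < c := integral_radialWeight_pos
  have key : ∀ ε > 0, r ^ (d + 4) * ((g x - 2 * ε) * c) ≤
      ∫ z in HalfSpace d, max (g z) 0 * oddKernel r x z := by
    intro ε hε
    have hU := contDiff_truncation hε hc hg hb
    calc r ^ (d + 4) * ((g x - 2 * ε) * c) ≤ r ^ (d + 4) * (truncation ε g x * c) := by
          gcongr
          exact sub_le_truncation hε g hx
      _ ≤ ∫ z, truncation ε g z * oddKernel r x z :=
          mul_le_integral_mul_oddKernel hU (tsupport_truncation_subset hε hc hb)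
            (fun z hz => lapE_truncation_nonneg hε hg hlap hz) hx hr
      _ = ∫ z in HalfSpace d, truncation ε g z * oddKernel r x z := by
          refine (setIntegral_eq_integral_of_forall_compl_eq_zero fun z hz => ?_).symm
          rw [truncation_of_notMem ε g hz, zero_mul]
      _ ≤ ∫ z in HalfSpace d, max (g z) 0 * oddKernel r x z := by
          refine setIntegral_mono_on
            (integrableOn_mul_oddKernel hU.continuous.continuousOn hr.le hx)
            (integrableOn_mul_oddKernel (hc.sup continuousOn_const) hr.le hx)
            (isOpen_halfSpace d).measurableSet fun z hz => ?_
          exact mul_le_mul_of_nonneg_right (truncation_le hε g z) (oddKernel_nonneg r hx hz)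
  have hlim : Tendsto (fun ε : ℝ => r ^ (d + 4) * ((g x - 2 * ε) * c)) (nhdsWithin 0 (Ioi 0))
      (nhds (r ^ (d + 4) * ((g x - 2 * 0) * c))) :=
    Tendsto.mono_left (Continuous.tendsto (by fun_prop) 0) nhdsWithin_le_nhds
  rw [mul_zero, sub_zero] at hlim
  exact le_of_tendsto hlim (eventually_nhdsWithin_of_forall key)

lemma oddKernel_mirror {d : ℕ} (r : ℝ) (x z : Euc d) :
    oddKernel r x (mirror d z) = -oddKernel r x z := by
  have h1 : ‖mirror d z - x‖ = ‖z - mirror d x‖ := by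
    conv_lhs => rw [← mirror_mirror x, ← map_sub, LinearIsometryEquiv.norm_map]
  have h2 : ‖mirror d z - mirror d x‖ = ‖z - x‖ := by
    rw [← map_sub, LinearIsometryEquiv.norm_map]
  simp only [oddKernel, capKernel, h1, h2]
  ring

lemma setIntegral_coord_mul_oddKernel {d : ℕ} (x : Euc d) {r : ℝ} (hr : 0 < r) :
    ∫ z in HalfSpace d, z 0 * oddKernel r x z =
      r ^ (d + 4) * (x 0 * ∫ y : Euc d, radialWeight y) := by
  have hcoord : Continuous fun z : Euc d => z 0 := by fun_prop
  have hInt : ∀ {f : Euc d → ℝ}, Continuous f → Integrable fun z => f z * oddKernel r x z := by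
    intro f hf
    simp only [oddKernel, mul_sub]
    exact (integrable_mul_capKernel hf hr.le _).sub (integrable_mul_capKernel hf hr.le _)
  have h1 : ∫ z in HalfSpace d, z 0 * oddKernel r x z = ∫ z, max (z 0) 0 * oddKernel r x z := by
    rw [← setIntegral_eq_integral_of_forall_compl_eq_zero (s := HalfSpace d)
      (f := fun z : Euc d => max (z 0) 0 * oddKernel r x z)]
    · refine setIntegral_congr_fun (isOpen_halfSpace d).measurableSet fun z hz => ?_
      have hz0 : 0 < z 0 := hz
      simp only [max_eq_left hz0.le]
    · intro z hz
      rw [max_eq_right (not_lt.1 hz), zero_mul]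
  have h2 : ∫ z, max (z 0) 0 * oddKernel r x z = -∫ z, max (-z 0) 0 * oddKernel r x z := by
    rw [← integral_neg, ← (mirror d).measurePreserving.integral_comp
      (mirror d).toHomeomorph.measurableEmbedding]
    refine integral_congr_ae (Eventually.of_forall fun z => ?_)
    simp only [mirror_apply_zero, oddKernel_mirror]
    ring
  have h3 : ∫ z, z 0 * oddKernel r x z = (∫ z, max (z 0) 0 * oddKernel r x z) -
      ∫ z, max (-z 0) 0 * oddKernel r x z := by
    rw [← integral_sub (hInt (by fun_prop)) (hInt (by fun_prop))]
    refine integral_congr_ae (Eventually.of_forall fun z => ?_)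
    rcases le_total (z 0) 0 with h | h <;> simp [h]
  have h4 : ∀ w : Euc d, ∫ z : Euc d, z 0 * capKernel r w z =
      r ^ (d + 4) * (w 0 * (∫ y : Euc d, radialWeight y) +
        r * ∫ y : Euc d, y 0 * radialWeight y) := by
    intro w
    have e := integral_mul_capKernel_pow (fun z : Euc d => z 0) w hr 1
    simp only [pow_one, PiLp.add_apply, PiLp.smul_apply, smul_eq_mul, add_mul] at e
    rw [e, integral_add (integrable_mul_radialWeight continuous_const), integral_const_mul]
    · simp only [mul_assoc, integral_const_mul]
    · exact integrable_mul_radialWeight (continuous_const.mul hcoord)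
  have h5 : ∫ z, z 0 * oddKernel r x z =
      r ^ (d + 4) * (2 * (x 0 * ∫ y : Euc d, radialWeight y)) := by
    simp only [oddKernel, mul_sub]
    rw [integral_sub (integrable_mul_capKernel hcoord hr.le _)
      (integrable_mul_capKernel hcoord hr.le _), h4, h4, mirror_apply_zero]
    ring
  linarith

lemma contDiff_const_mul_coord {d : ℕ} (K : ℝ) : ContDiff ℝ 2 fun z : Euc d => K * z 0 :=
  contDiff_const.mul (by fun_prop)

lemma lapE_const_mul_coord_sub {d : ℕ} (K : ℝ) {v : Euc d → ℝ} {z : Euc d}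
    (hv : ContDiffAt ℝ 2 v z) : lapE (fun w => K * w 0 - v w) z = - lapE v z := by
  unfold lapE
  rw [← Finset.sum_neg_distrib]
  refine Finset.sum_congr rfl fun i _ => ?_
  set L : Euc d →L[ℝ] ℝ := K • EuclideanSpace.proj 0
  have hL : (fun w : Euc d => K * w 0 - v w) = fun w => L w - v w := by
    funext w
    simp [L]
  have hev : ∀ᶠ w in nhds z, ContDiffAt ℝ 2 v w := hv.eventually (by simp)
  have h1 : (fun w => fderiv ℝ (fun w : Euc d => K * w 0 - v w) w (EuclideanSpace.single i 1))
      =ᶠ[nhds z] fun w => L (EuclideanSpace.single i 1) -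
        fderiv ℝ v w (EuclideanSpace.single i 1) := by
    filter_upwards [hev] with w hw
    rw [hL, fderiv_fun_sub L.differentiableAt (hw.differentiableAt (by norm_num)), L.fderiv]
    simp
  rw [h1.fderiv_eq, fderiv_const_sub]
  simp

lemma IsPosSolHS.le_mul_coord {d : ℕ} {v : Euc d → ℝ} (hv : IsPosSolHS v) (x₀ : Euc d) (L : ℝ) :
    ∃ K : ℝ, ∀ x ∈ HalfSpace d, ‖x - x₀‖ ≤ L → v x ≤ K * x 0 := by
  obtain ⟨hc, hg, hlap, hpos, hb⟩ := hv
  set c := ∫ y : Euc d, radialWeight y with hcdef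
  have hc0 : 0 < c := integral_radialWeight_pos
  have hcoord : Continuous fun z : Euc d => z 0 := by fun_prop
  set S : Set (Euc d) := HalfSpace d ∩ closedBall x₀ (L + 1) with hS
  have hSm : MeasurableSet S := (isOpen_halfSpace d).measurableSet.inter measurableSet_closedBall
  have hInt : IntegrableOn (fun z => v z * z 0) S :=
    (((hc.mono inter_subset_left).mul hcoord.continuousOn).integrableOn_compact
      ((isCompact_closedBall x₀ (L + 1)).inter_left isClosed_closure)).mono_set
      (inter_subset_inter_left _ subset_closure)
  refine ⟨4 * (∫ z in S, v z * z 0) / c, fun x hx hxL => ?_⟩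
  have h1 := mul_le_setIntegral_posPart_mul_oddKernel hc hg hlap (fun z hz => (hb z hz).le) hx
    one_pos
  have h2 : ∫ z in HalfSpace d, max (v z) 0 * oddKernel 1 x z =
      ∫ z in S, max (v z) 0 * oddKernel 1 x z := by
    refine setIntegral_eq_of_subset_of_forall_sdiff_eq_zero (isOpen_halfSpace d).measurableSet
      inter_subset_left fun z hz => ?_
    rw [oddKernel_eq_zero zero_le_one hx hz.1, mul_zero]
    by_contra! h
    refine hz.2 ⟨hz.1, ?_⟩
    rw [mem_closedBall, dist_eq_norm]
    linarith [norm_sub_le_norm_sub_add_norm_sub z x x₀]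
  have h3 : ∫ z in S, max (v z) 0 * oddKernel 1 x z ≤ ∫ z in S, (4 * x 0) * (v z * z 0) := by
    refine setIntegral_mono_on ?_ (hInt.const_mul _) hSm fun z hz => ?_
    · exact (integrableOn_mul_oddKernel (hc.sup continuousOn_const) zero_le_one hx).mono_set
        inter_subset_left
    · rw [max_eq_left (hpos z hz.1).le]
      nlinarith [mul_le_mul_of_nonneg_left (oddKernel_le 1 hx hz.1) (hpos z hz.1).le]
  rw [integral_const_mul] at h3
  rw [h2, one_pow, one_mul] at h1
  rw [div_mul_eq_mul_div, le_div_iff₀ hc0]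
  linarith

lemma IsPosSolHS.setIntegral_mul_oddKernel_le {d : ℕ} {v : Euc d → ℝ} (hv : IsPosSolHS v)
    {x : Euc d} (hx : x ∈ HalfSpace d) {r : ℝ} (hr : 0 < r) :
    ∫ z in HalfSpace d, v z * oddKernel r x z ≤
      r ^ (d + 4) * (v x * ∫ y : Euc d, radialWeight y) := by
  obtain ⟨K, hK⟩ := hv.le_mul_coord x r
  obtain ⟨hc, hg, hlap, hpos, hb⟩ := hv
  have hlin : Continuous fun z : Euc d => K * z 0 := by fun_prop
  have h1 := mul_le_setIntegral_posPart_mul_oddKernel (g := fun z => K * z 0 - v z)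
    (hlin.continuousOn.sub hc) ((contDiff_const_mul_coord K).contDiffOn.sub hg)
    (fun z hz => by
      rw [lapE_const_mul_coord_sub K (hg.contDiffAt ((isOpen_halfSpace d).mem_nhds hz)),
        hlap z hz, neg_zero])
    (fun z hz => by simp [hz, hb z hz]) hx hr
  have h2 : ∫ z in HalfSpace d, max (K * z 0 - v z) 0 * oddKernel r x z =
      ∫ z in HalfSpace d, (K * (z 0 * oddKernel r x z) - v z * oddKernel r x z) := by
    refine setIntegral_congr_fun (isOpen_halfSpace d).measurableSet fun z hz => ?_
    rcases le_total ‖z - x‖ r with h | h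
    · simp only [max_eq_left (sub_nonneg.2 (hK z hz h))]
      ring
    · simp [oddKernel_eq_zero hr.le hx hz h]
  rw [h2, integral_sub
    ((integrableOn_mul_oddKernel (by fun_prop) hr.le hx).const_mul K)
    (integrableOn_mul_oddKernel hc hr.le hx), integral_const_mul,
    setIntegral_coord_mul_oddKernel x hr] at h1
  linarith

/-- Harnack inequality for the quotient `v(z) / z₁`. -/
lemma IsPosSolHS.harnack {d : ℕ} {v : Euc d → ℝ} (hv : IsPosSolHS v) {x y : Euc d}
    (hx : x ∈ HalfSpace d) (hy : y ∈ HalfSpace d) :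
    v x * y 0 ≤ 2 ^ (d + 4) * (v y * x 0) := by
  have hx0 : 0 < x 0 := hx
  have hy0 : 0 < y 0 := hy
  set r : ℝ := ‖x - mirror d y‖ + ‖x - y‖ + 1 with hrdef
  have hr : 0 < r := by positivity
  have hlow := hv.setIntegral_mul_oddKernel_le hy (r := 2 * r) (by positivity)
  obtain ⟨hc, hg, hlap, hpos, hb⟩ := hv
  have hup := mul_le_setIntegral_posPart_mul_oddKernel hc hg hlap (fun z hz => (hb z hz).le) hx hr
  set c := ∫ y : Euc d, radialWeight y with hcdef
  have hc0 : 0 < c := integral_radialWeight_pos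
  have hcmp : ∫ z in HalfSpace d, y 0 * (max (v z) 0 * oddKernel r x z) ≤
      ∫ z in HalfSpace d, x 0 * (v z * oddKernel (2 * r) y z) := by
    refine setIntegral_mono_on
      ((integrableOn_mul_oddKernel (hc.sup continuousOn_const) hr.le hx).const_mul _)
      ((integrableOn_mul_oddKernel hc (by positivity) hy).const_mul _)
      (isOpen_halfSpace d).measurableSet fun z hz => ?_
    have hvz := hpos z hz
    rw [max_eq_left hvz.le]
    rcases le_total r ‖z - x‖ with h | h
    · rw [oddKernel_eq_zero hr.le hx hz h]
      have := mul_nonneg hx0.le (mul_nonneg hvz.le (oddKernel_nonneg (2 * r) hy hz))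
      simpa using this
    · have h1 := norm_sub_le_norm_sub_add_norm_sub z x y
      have h2 := norm_sub_le_norm_sub_add_norm_sub z x (mirror d y)
      have h3 := norm_nonneg (x - y)
      have h4 := norm_nonneg (x - mirror d y)
      rw [oddKernel_eq (r := 2 * r) (by linarith) (by linarith)]
      calc y 0 * (v z * oddKernel r x z) ≤ y 0 * (v z * (4 * (z 0 * x 0))) := by
            gcongr
            exact oddKernel_le r hx hz
        _ = x 0 * (v z * (4 * (z 0 * y 0))) := by ring
  rw [integral_const_mul, integral_const_mul] at hcmp
  have hfin : y 0 * (r ^ (d + 4) * (v x * c)) ≤ x 0 * ((2 * r) ^ (d + 4) * (v y * c)) :=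
    (mul_le_mul_of_nonneg_left hup hy0.le).trans
      (hcmp.trans (mul_le_mul_of_nonneg_left hlow hx0.le))
  rw [mul_pow] at hfin
  have hrc : 0 < r ^ (d + 4) * c := by positivity
  refine le_of_mul_le_mul_left ?_ hrc
  linarith

/-- Any positive solution on the half-space `H` satisfies
`C₁ z₁ ≤ v(z) ≤ C₂ z₁` on `H` for some constants `0 < C₁ ≤ C₂`; in particular
`v(z) = O(z₁)`. -/
theorem statement11 {d : ℕ} (v : EuclideanSpace ℝ (Fin (d+2)) → ℝ)
    (hv : IsPosSolHS v) :
    ∃ C₁ C₂ : ℝ, 0 < C₁ ∧ C₁ ≤ C₂ ∧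
      ∀ z ∈ HalfSpace d, C₁ * z 0 ≤ v z ∧ v z ≤ C₂ * z 0 := by
  set e : Euc d := EuclideanSpace.single 0 1 with he
  have he0 : e 0 = 1 := by simp [he]
  have heH : e ∈ HalfSpace d := by
    rw [HalfSpace, mem_ofPred_eq, he0]
    exact one_pos
  have hve : 0 < v e := hv.2.2.2.1 e heH
  have hpow : (1 : ℝ) ≤ 2 ^ (d + 4) := one_le_pow₀ one_le_two
  refine ⟨v e / 2 ^ (d + 4), 2 ^ (d + 4) * v e, by positivity, ?_, fun z hz => ⟨?_, ?_⟩⟩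
  · exact (div_le_self hve.le hpow).trans (le_mul_of_one_le_left hve.le hpow)
  · have := hv.harnack heH hz
    rw [he0, mul_one] at this
    rw [div_mul_eq_mul_div, div_le_iff₀ (by positivity)]
    linarith
  · have := hv.harnack hz heH
    rw [he0, mul_one] at this
    linarith
end
end

section
/- Let v be a positive solution on the half-space H. Then there exist a number N̄ > 0 and a continuous function φ on the closed upper unit hemisphere {θ ∈ ℝ^N : |θ| = 1, θ₁ ≥ 0}, vanishing on the equator {θ₁ = 0} and positive on the open hemisphere, such that the positively homogeneous function w(z) := |z|^{N̄} φ(z/|z|) is harmonic on H (equivalently, N̄(N̄−1) + N̄(N−1) is an eigenvalue of the spherical Laplacian with Dirichlet conditions on the hemisphere and φ a corresponding eigenfunction), and sup over θ in the closed upper hemisphere of |r^{−N̄} v(rθ) − φ(θ)| tends to 0 as r → +∞. -/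
open MeasureTheory Filter Set Metric

noncomputable section

/-- Continuous nonnegative functions which vanish outside the open half-space `{x | 0 < x 0}` and
are harmonic inside it. -/
structure IsHarmonicZeroExt {n : ℕ} (w : (Fin (n + 1) → ℝ) → ℝ) : Prop where
  continuous : Continuous w
  eq_zero : ∀ x, x 0 ≤ 0 → w x = 0
  nonneg : ∀ x, 0 ≤ w x
  contDiffAt : ∀ x, 0 < x 0 → ContDiffAt ℝ 2 w x
  laplacian_eq_zero : ∀ x, 0 < x 0 →
    ∑ i, fderiv ℝ (fun z => fderiv ℝ w z (Pi.single i 1)) x (Pi.single i 1) = 0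

/-- Green's identity for a shifted harmonic function on the box `[0, A] × [-A, A]ⁿ`. -/
lemma IsHarmonicZeroExt.green_shift {n : ℕ} {w : (Fin (n + 1) → ℝ) → ℝ} (hw : IsHarmonicZeroExt w)
    {G : (Fin (n + 1) → ℝ) → ℝ} {dG : Fin (n + 1) → (Fin (n + 1) → ℝ) → ℝ}
    {ddG : Fin (n + 1) → (Fin (n + 1) → ℝ) → (Fin (n + 1) → ℝ) →L[ℝ] ℝ}
    {L : (Fin (n + 1) → ℝ) → ℝ}
    (hG : ∀ x, HasFDerivAt G
      (∑ i, dG i x • (ContinuousLinearMap.proj i : (Fin (n + 1) → ℝ) →L[ℝ] ℝ)) x)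
    (hdG : ∀ i x, HasFDerivAt (dG i) (ddG i x) x)
    (hL : ∀ x, ∑ i, ddG i x (Pi.single i 1) = L x) (hLc : Continuous L)
    {A : ℝ} (hA0 : 0 ≤ A)
    (hGA : ∀ x, 0 ≤ x 0 → (∃ i, A ≤ |x i|) → G x = 0)
    (hdGA : ∀ x, 0 ≤ x 0 → (∃ i, A ≤ |x i|) → ∀ i, dG i x = 0)
    (hG0 : ∀ x, x 0 = 0 → G x = 0) {ε : ℝ} (hε : 0 < ε) :
    ∫ x in Set.Icc (Fin.cons 0 fun _ => -A) (fun _ => A), w (x + Pi.single 0 ε) * L x =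
      - ∫ x in Set.Icc (fun _ : Fin n => -A) (fun _ => A),
          w (Fin.cons ε x) * dG 0 (Fin.cons 0 x) := by
  set p : Fin (n + 1) → ℝ := Pi.single 0 ε with hp
  have hpos : ∀ x : Fin (n + 1) → ℝ, 0 ≤ x 0 → 0 < (x + p) 0 := by
    intro x hx
    simp only [hp, Pi.add_apply, Pi.single_eq_same]
    linarith
  have hwd : ∀ x : Fin (n + 1) → ℝ, 0 ≤ x 0 →
      HasFDerivAt (fun x => w (x + p)) (fderiv ℝ w (x + p)) x := by
    intro x hx
    have h1 : HasFDerivAt w (fderiv ℝ w (x + p)) (x + p) :=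
      ((hw.contDiffAt _ (hpos x hx)).differentiableAt (by norm_num)).hasFDerivAt
    exact (hasFDerivAt_comp_add_right p).2 h1
  have hwdd : ∀ (i : Fin (n + 1)) (x : Fin (n + 1) → ℝ), 0 ≤ x 0 →
      HasFDerivAt (fun x => fderiv ℝ w (x + p) (Pi.single i 1))
        (fderiv ℝ (fun z => fderiv ℝ w z (Pi.single i 1)) (x + p)) x := by
    intro i x hx
    have h1 : ContDiffAt ℝ 1 (fderiv ℝ w) (x + p) :=
      (hw.contDiffAt _ (hpos x hx)).fderiv_right (by norm_num)
    have h2 : DifferentiableAt ℝ (fun z => fderiv ℝ w z (Pi.single i 1)) (x + p) :=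
      (h1.differentiableAt (by norm_num)).clm_apply (differentiableAt_const _)
    exact (hasFDerivAt_comp_add_right p).2 h2.hasFDerivAt
  set f : Fin (n + 1) → (Fin (n + 1) → ℝ) → ℝ := fun i x =>
    w (x + p) * dG i x - G x * fderiv ℝ w (x + p) (Pi.single i 1) with hf
  set f' : Fin (n + 1) → (Fin (n + 1) → ℝ) → (Fin (n + 1) → ℝ) →L[ℝ] ℝ := fun i x =>
    (w (x + p) • ddG i x + dG i x • fderiv ℝ w (x + p)) -
      (G x • fderiv ℝ (fun z => fderiv ℝ w z (Pi.single i 1)) (x + p) +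
        (fderiv ℝ w (x + p) (Pi.single i 1)) •
          (∑ j, dG j x • (ContinuousLinearMap.proj j : (Fin (n + 1) → ℝ) →L[ℝ] ℝ))) with hf'
  have hff' : ∀ i x, 0 ≤ x 0 → HasFDerivAt (f i) (f' i x) x := fun i x hx =>
    ((hwd x hx).mul (hdG i x)).sub ((hG x).mul (hwdd i x hx))
  have hdiv : ∀ x, 0 ≤ x 0 → ∑ i, f' i x (Pi.single i 1) = w (x + p) * L x := by
    intro x hx
    have h1 : ∀ i, f' i x (Pi.single i 1) = w (x + p) * ddG i x (Pi.single i 1) -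
        G x * fderiv ℝ (fun z => fderiv ℝ w z (Pi.single i 1)) (x + p) (Pi.single i 1) := by
      intro i
      have h2 : ∑ j, dG j x * (Pi.single i (1 : ℝ) : Fin (n + 1) → ℝ) j = dG i x := by
        simp [Pi.single_apply]
      simp only [hf', sub_apply, add_apply, smul_apply, sum_apply,
        ContinuousLinearMap.proj_apply, smul_eq_mul, h2]
      ring
    simp only [h1]
    rw [Finset.sum_sub_distrib, ← Finset.mul_sum, ← Finset.mul_sum, hL,
      hw.laplacian_eq_zero _ (hpos x hx), mul_zero, sub_zero]
  set a : Fin (n + 1) → ℝ := Fin.cons 0 fun _ => -A with ha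
  have hle : a ≤ fun _ => A := by
    intro i
    refine Fin.cases ?_ (fun j => ?_) i
    · simpa [ha] using hA0
    · simp only [ha, Fin.cons_succ]; linarith
  have hbox : ∀ x ∈ Set.Icc a (fun _ => A), 0 ≤ x 0 := fun x hx => by simpa [ha] using hx.1 0
  have hcont : Continuous fun x => w (x + p) * L x :=
    (hw.continuous.comp (continuous_add_const p)).mul hLc
  have key := integral_divergence_of_hasFDerivAt_off_countable' a (fun _ => A) hle f f' ∅
    Set.countable_empty
    (fun i x hx => (hff' i x (hbox x hx)).continuousAt.continuousWithinAt)
    (fun x hx i => hff' i x (by simpa [ha] using (hx.1 0 (Set.mem_univ _)).1.le))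
    ((hcont.continuousOn.integrableOn_compact isCompact_Icc).congr_fun
      (fun x hx => (hdiv x (hbox x hx)).symm) measurableSet_Icc)
  rw [setIntegral_congr_fun measurableSet_Icc (fun x hx => hdiv x (hbox x hx))] at key
  rw [key, Fin.sum_univ_succ]
  have hz : ∀ i x, 0 ≤ x 0 → (∃ j, A ≤ |x j|) → f i x = 0 := by
    intro i x hx hj
    simp [hf, hGA x hx hj, hdGA x hx hj i]
  have hsum : ∀ i : Fin n,
      ((∫ x in Set.Icc (a ∘ i.succ.succAbove) ((fun _ => A) ∘ i.succ.succAbove),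
          f i.succ (i.succ.insertNth A x)) -
        ∫ x in Set.Icc (a ∘ i.succ.succAbove) ((fun _ => A) ∘ i.succ.succAbove),
          f i.succ (i.succ.insertNth (a i.succ) x)) = 0 := by
    intro i
    have h0 : ∀ t : ℝ, |t| = A → ∫ x in Set.Icc (a ∘ i.succ.succAbove)
        ((fun _ => A) ∘ i.succ.succAbove), f i.succ (i.succ.insertNth t x) = 0 := by
      intro t ht
      refine setIntegral_eq_zero_of_forall_eq_zero fun x hx => hz _ _ ?_ ⟨i.succ, by simp [ht]⟩
      obtain ⟨j, hj⟩ : ∃ j, i.succ.succAbove j = 0 :=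
        Fin.exists_succAbove_eq (Fin.succ_ne_zero i).symm
      have h3 := hx.1 j
      rw [Function.comp_apply, hj] at h3
      rw [← hj, Fin.insertNth_apply_succAbove]
      simpa [ha] using h3
    rw [h0 A (abs_of_nonneg hA0), h0 _ (by simp [ha, abs_of_nonneg hA0]), sub_zero]
  rw [Finset.sum_eq_zero fun i _ => hsum i, add_zero]
  have h4 : ∫ x in Set.Icc (a ∘ (0 : Fin (n + 1)).succAbove)
      ((fun _ => A) ∘ (0 : Fin (n + 1)).succAbove), f 0 ((0 : Fin (n + 1)).insertNth A x) = 0 :=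
    setIntegral_eq_zero_of_forall_eq_zero fun x _ =>
      hz _ _ (by simpa using hA0) ⟨0, by simp [abs_of_nonneg hA0]⟩
  have hfc : a ∘ (0 : Fin (n + 1)).succAbove = fun _ => -A := by
    ext j; simp [ha]
  rw [h4, zero_sub, hfc]
  congr 1
  refine setIntegral_congr_fun measurableSet_Icc fun x _ => ?_
  have h5 : (Fin.cons 0 x : Fin (n + 1) → ℝ) + p = Fin.cons ε x := by
    ext j
    refine Fin.cases ?_ (fun k => ?_) j <;> simp [hp]
  have h6 : (0 : Fin (n + 1)).insertNth (a 0) x = (Fin.cons 0 x : Fin (n + 1) → ℝ) := by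
    rw [Fin.insertNth_zero']; rfl
  simp only [h6]
  simp [hf, h5, hG0]

/-- Harmonic functions vanishing on the boundary of the half-space are orthogonal to Laplacians
of compactly supported test functions which vanish on that boundary. -/
lemma IsHarmonicZeroExt.integral_mul_laplacian {n : ℕ} {w : (Fin (n + 1) → ℝ) → ℝ}
    (hw : IsHarmonicZeroExt w)
    {G : (Fin (n + 1) → ℝ) → ℝ} {dG : Fin (n + 1) → (Fin (n + 1) → ℝ) → ℝ}
    {ddG : Fin (n + 1) → (Fin (n + 1) → ℝ) → (Fin (n + 1) → ℝ) →L[ℝ] ℝ}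
    {L : (Fin (n + 1) → ℝ) → ℝ}
    (hG : ∀ x, HasFDerivAt G
      (∑ i, dG i x • (ContinuousLinearMap.proj i : (Fin (n + 1) → ℝ) →L[ℝ] ℝ)) x)
    (hdG : ∀ i x, HasFDerivAt (dG i) (ddG i x) x)
    (hL : ∀ x, ∑ i, ddG i x (Pi.single i 1) = L x) (hLc : Continuous L)
    {A : ℝ} (hA0 : 0 ≤ A)
    (hGA : ∀ x, 0 ≤ x 0 → (∃ i, A ≤ |x i|) → G x = 0)
    (hdGA : ∀ x, 0 ≤ x 0 → (∃ i, A ≤ |x i|) → ∀ i, dG i x = 0)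
    (hLA : ∀ x, 0 ≤ x 0 → (∃ i, A ≤ |x i|) → L x = 0)
    (hG0 : ∀ x, x 0 = 0 → G x = 0) :
    ∫ x, w x * L x = 0 := by
  have hdGc : Continuous (dG 0) :=
    continuous_iff_continuousAt.2 fun x => (hdG 0 x).continuousAt
  have c1 : Continuous fun ε : ℝ => ∫ x in Set.Icc (Fin.cons 0 fun _ => -A) (fun _ => A),
      w (x + Pi.single (0 : Fin (n + 1)) ε) * L x := by
    refine continuous_parametric_integral_of_continuous ?_ isCompact_Icc
    refine Continuous.mul (hw.continuous.comp ?_) (hLc.comp continuous_snd)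
    exact continuous_snd.add ((continuous_single (0 : Fin (n + 1))).comp continuous_fst)
  have c2 : Continuous fun ε : ℝ => - ∫ x in Set.Icc (fun _ : Fin n => -A) (fun _ => A),
          w (Fin.cons ε x) * dG 0 (Fin.cons 0 x) := by
    refine (continuous_parametric_integral_of_continuous ?_ isCompact_Icc).neg
    refine Continuous.mul (hw.continuous.comp ?_) (hdGc.comp ?_)
    · exact Continuous.finCons continuous_fst continuous_snd
    · exact Continuous.finCons continuous_const continuous_snd
  have hlim := tendsto_nhds_unique_of_eventuallyEq (l := nhdsWithin (0 : ℝ) (Set.Ioi 0))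
    ((c1.tendsto 0).mono_left nhdsWithin_le_nhds) ((c2.tendsto 0).mono_left nhdsWithin_le_nhds)
    (by
      filter_upwards [self_mem_nhdsWithin] with ε hε
      exact hw.green_shift hG hdG hL hLc hA0 hGA hdGA hG0 hε)
  have h0 : ∀ x : Fin n → ℝ, w (Fin.cons 0 x) = 0 := fun x => hw.eq_zero _ (by simp)
  simp only [Pi.single_zero, add_zero, h0, zero_mul, integral_zero, neg_zero] at hlim
  rw [← hlim, setIntegral_eq_integral_of_forall_compl_eq_zero]
  intro x hx
  by_cases hx0 : x 0 ≤ 0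
  · rw [hw.eq_zero x hx0, zero_mul]
  · rw [hLA x (not_le.1 hx0).le, mul_zero]
    by_contra hc
    push Not at hc
    refine hx ⟨fun i => ?_, fun i => (abs_lt.1 (hc i)).2.le⟩
    refine Fin.cases ?_ (fun j => ?_) i
    · simpa using (not_le.1 hx0).le
    · simpa using (abs_lt.1 (hc j.succ)).1.le

lemma hasDerivAt_max_zero_pow (k : ℕ) (r : ℝ) :
    HasDerivAt (fun r : ℝ => max r 0 ^ (k + 2)) ((k + 2) * max r 0 ^ (k + 1)) r := by
  have hne : ∀ y : ℝ, y ≠ 0 →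
      HasDerivAt (fun r : ℝ => max r 0 ^ (k + 2)) ((k + 2) * max y 0 ^ (k + 1)) y := by
    intro y hy
    rcases lt_or_gt_of_ne hy with h | h
    · rw [max_eq_right h.le, zero_pow (Nat.succ_ne_zero k), mul_zero]
      refine (hasDerivAt_const y (0 : ℝ)).congr_of_eventuallyEq ?_
      filter_upwards [gt_mem_nhds h] with z hz
      simp [max_eq_right hz.le]
    · rw [max_eq_left h.le]
      have h1 := hasDerivAt_pow (k + 2) y
      push_cast at h1
      refine h1.congr_of_eventuallyEq ?_
      filter_upwards [lt_mem_nhds h] with z hz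
      simp [max_eq_left hz.le]
  by_cases hr : r = 0
  · subst hr
    exact hasDerivAt_of_hasDerivAt_of_ne (g := fun y => (k + 2) * max y 0 ^ (k + 1)) hne
      (by fun_prop) (by fun_prop)
  · exact hne r hr

/-- Squared Euclidean distance in coordinates. -/
def sqDist {n : ℕ} (y x : Fin (n + 1) → ℝ) : ℝ := ∑ i, (x i - y i) ^ 2

/-- Reflection across the hyperplane `{x | x 0 = 0}`. -/
def reflZero {n : ℕ} (y : Fin (n + 1) → ℝ) : Fin (n + 1) → ℝ := Function.update y 0 (-(y 0))

lemma sqDist_nonneg {n : ℕ} (y x : Fin (n + 1) → ℝ) : 0 ≤ sqDist y x :=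
  Finset.sum_nonneg fun _ _ => sq_nonneg _

lemma sqDist_reflZero {n : ℕ} (y x : Fin (n + 1) → ℝ) :
    sqDist (reflZero y) x = sqDist y x + 4 * x 0 * y 0 := by
  simp only [sqDist, reflZero, Fin.sum_univ_succ, Function.update_self, ne_eq, Fin.succ_ne_zero,
    not_false_eq_true, Function.update_of_ne]
  ring

@[fun_prop]
lemma continuous_sqDist {n : ℕ} (y : Fin (n + 1) → ℝ) : Continuous (sqDist y) := by
  unfold sqDist; fun_prop

lemma sq_sub_le_sqDist {n : ℕ} (y x : Fin (n + 1) → ℝ) (i : Fin (n + 1)) :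
    (x i - y i) ^ 2 ≤ sqDist y x :=
  Finset.single_le_sum (f := fun i => (x i - y i) ^ 2) (fun _ _ => sq_nonneg _) (Finset.mem_univ i)

lemma hasFDerivAt_sqDist {n : ℕ} (y x : Fin (n + 1) → ℝ) :
    HasFDerivAt (sqDist y)
      (∑ i, (2 * (x i - y i)) • (ContinuousLinearMap.proj i : (Fin (n + 1) → ℝ) →L[ℝ] ℝ)) x := by
  unfold sqDist
  refine HasFDerivAt.fun_sum fun i _ => ?_
  have h := ((hasFDerivAt_apply (𝕜 := ℝ) i x).sub_const (y i)).pow 2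
  simpa using h

/-- The truncated power `(s - |x - y|²)₊ ^ k`. -/
def bump {n : ℕ} (k : ℕ) (s : ℝ) (y x : Fin (n + 1) → ℝ) : ℝ := max (s - sqDist y x) 0 ^ k

@[fun_prop]
lemma continuous_bump {n : ℕ} (k : ℕ) (s : ℝ) (y : Fin (n + 1) → ℝ) : Continuous (bump k s y) := by
  unfold bump; fun_prop

lemma bump_nonneg {n : ℕ} (k : ℕ) (s : ℝ) (y x : Fin (n + 1) → ℝ) : 0 ≤ bump k s y x :=
  pow_nonneg (le_max_right _ _) _

lemma bump_eq_zero {n : ℕ} {k : ℕ} (hk : k ≠ 0) {s : ℝ} {y x : Fin (n + 1) → ℝ}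
    (h : s ≤ sqDist y x) : bump k s y x = 0 := by
  rw [bump, max_eq_right (by linarith), zero_pow hk]

lemma hasFDerivAt_bump {n : ℕ} (k : ℕ) (s : ℝ) (y x : Fin (n + 1) → ℝ) :
    HasFDerivAt (bump (k + 2) s y)
      (∑ i, (-(2 * (k + 2)) * (bump (k + 1) s y x * (x i - y i))) •
        (ContinuousLinearMap.proj i : (Fin (n + 1) → ℝ) →L[ℝ] ℝ)) x := by
  have h := (hasDerivAt_max_zero_pow k (s - sqDist y x)).comp_hasFDerivAt x
    ((hasFDerivAt_sqDist y x).const_sub s)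
  refine h.congr_fderiv ?_
  rw [← Finset.sum_neg_distrib, Finset.smul_sum]
  refine Finset.sum_congr rfl fun i _ => ?_
  rw [← neg_smul, smul_smul, bump]
  congr 1
  ring

/-- The second derivatives of `bump 3`. -/
def bumpHess {n : ℕ} (s : ℝ) (y : Fin (n + 1) → ℝ) (i : Fin (n + 1)) (x : Fin (n + 1) → ℝ) :
    (Fin (n + 1) → ℝ) →L[ℝ] ℝ :=
  (-6 : ℝ) • (bump 2 s y x • (ContinuousLinearMap.proj i : (Fin (n + 1) → ℝ) →L[ℝ] ℝ) +
    (x i - y i) • (∑ j, (-4 * (bump 1 s y x * (x j - y j))) •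
        (ContinuousLinearMap.proj j : (Fin (n + 1) → ℝ) →L[ℝ] ℝ)))

lemma hasFDerivAt_bump_grad {n : ℕ} (s : ℝ) (y : Fin (n + 1) → ℝ) (i : Fin (n + 1))
    (x : Fin (n + 1) → ℝ) :
    HasFDerivAt (fun x => -6 * (bump 2 s y x * (x i - y i))) (bumpHess s y i x) x := by
  have h2 := ((hasFDerivAt_bump 0 s y x).mul
    ((hasFDerivAt_apply (𝕜 := ℝ) i x).sub_const (y i))).const_mul (-6 : ℝ)
  refine h2.congr_fderiv ?_
  norm_num [bumpHess]

lemma sum_bumpHess {n : ℕ} (s : ℝ) (y x : Fin (n + 1) → ℝ) :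
    ∑ i, bumpHess s y i x (Pi.single i 1) =
      24 * s * bump 1 s y x - (24 + 6 * (n + 1)) * bump 2 s y x := by
  have h1 : ∀ i, bumpHess s y i x (Pi.single i 1) =
      24 * bump 1 s y x * (x i - y i) ^ 2 - 6 * bump 2 s y x := by
    intro i
    have h2 : ∑ j, -4 * (bump 1 s y x * (x j - y j)) *
        (Pi.single i (1 : ℝ) : Fin (n + 1) → ℝ) j = -4 * (bump 1 s y x * (x i - y i)) := by
      simp [Pi.single_apply]
    simp only [bumpHess, smul_apply, add_apply, sum_apply, ContinuousLinearMap.proj_apply,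
      smul_eq_mul, h2, Pi.single_eq_same]
    ring
  simp only [h1]
  rw [Finset.sum_sub_distrib, ← Finset.mul_sum]
  simp only [Finset.sum_const, Finset.card_univ, Fintype.card_fin, nsmul_eq_mul]
  have h3 : bump 2 s y x = (s - sqDist y x) * bump 1 s y x := by
    simp only [bump, pow_one, pow_two]
    rcases le_total (s - sqDist y x) 0 with h | h
    · simp [max_eq_right h]
    · simp [max_eq_left h]
  change 24 * bump 1 s y x * sqDist y x - _ = _
  push_cast
  linear_combination (24 : ℝ) * h3

/-- The difference of two bumps centred at `y` and at its mirror image. -/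
def oddBump {n : ℕ} (k : ℕ) (s : ℝ) (y x : Fin (n + 1) → ℝ) : ℝ :=
  bump k s y x - bump k s (reflZero y) x

@[fun_prop]
lemma continuous_oddBump {n : ℕ} (k : ℕ) (s : ℝ) (y : Fin (n + 1) → ℝ) :
    Continuous (oddBump k s y) := by
  unfold oddBump; fun_prop

/-- A bound for the coordinates of the points at squared distance less than `s` from `y`. -/
def supportRadius {n : ℕ} (s : ℝ) (y : Fin (n + 1) → ℝ) : ℝ := ‖y‖ + |s| + 1

lemma supportRadius_nonneg {n : ℕ} (s : ℝ) (y : Fin (n + 1) → ℝ) : 0 ≤ supportRadius s y := by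
  unfold supportRadius; positivity

lemma le_sqDist_of_supportRadius_le {n : ℕ} {s : ℝ} {y x : Fin (n + 1) → ℝ} {i : Fin (n + 1)}
    (h : supportRadius s y ≤ |x i|) : s ≤ sqDist y x := by
  refine le_trans ?_ (sq_sub_le_sqDist y x i)
  have h1 : |y i| ≤ ‖y‖ := norm_le_pi_norm y i
  have h2 : |x i| - |y i| ≤ |x i - y i| := abs_sub_abs_le_abs_sub _ _
  unfold supportRadius at h
  rw [← sq_abs (x i - y i)]
  nlinarith [le_abs_self s, abs_nonneg s]

lemma le_sqDist_reflZero {n : ℕ} {s : ℝ} {y x : Fin (n + 1) → ℝ} (hy : 0 ≤ y 0) (hx : 0 ≤ x 0)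
    (h : s ≤ sqDist y x) : s ≤ sqDist (reflZero y) x := by
  rw [sqDist_reflZero]; nlinarith [mul_nonneg hx hy]

lemma IsHarmonicZeroExt.integral_oddBump {n : ℕ} {w : (Fin (n + 1) → ℝ) → ℝ}
    (hw : IsHarmonicZeroExt w) {y : Fin (n + 1) → ℝ} (hy : 0 ≤ y 0) (s : ℝ) :
    ∫ x, w x * (24 * s * oddBump 1 s y x - (24 + 6 * (n + 1)) * oddBump 2 s y x) = 0 := by
  have key : ∀ k : ℕ, k ≠ 0 → ∀ x : Fin (n + 1) → ℝ, 0 ≤ x 0 →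
      (∃ i, supportRadius s y ≤ |x i|) → bump k s y x = 0 ∧ bump k s (reflZero y) x = 0 := by
    rintro k hk x hx ⟨i, hi⟩
    have h := le_sqDist_of_supportRadius_le hi
    exact ⟨bump_eq_zero hk h, bump_eq_zero hk (le_sqDist_reflZero hy hx h)⟩
  refine hw.integral_mul_laplacian (G := oddBump 3 s y)
    (dG := fun i x => -6 * (bump 2 s y x * (x i - y i)) -
      -6 * (bump 2 s (reflZero y) x * (x i - reflZero y i)))
    (ddG := fun i x => bumpHess s y i x - bumpHess s (reflZero y) i x)
    (A := supportRadius s y) ?_ ?_ ?_ (by fun_prop) (supportRadius_nonneg s y) ?_ ?_ ?_ ?_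
  · intro x
    have h := (hasFDerivAt_bump 1 s y x).sub (hasFDerivAt_bump 1 s (reflZero y) x)
    refine h.congr_fderiv ?_
    rw [← Finset.sum_sub_distrib]
    refine Finset.sum_congr rfl fun i _ => ?_
    rw [← sub_smul]
    norm_num
  · exact fun i x => (hasFDerivAt_bump_grad s y i x).sub (hasFDerivAt_bump_grad s (reflZero y) i x)
  · intro x
    simp only [sub_apply]
    rw [Finset.sum_sub_distrib, sum_bumpHess, sum_bumpHess, oddBump, oddBump]
    ring
  · intro x hx hi
    simp [oddBump, key 3 (by norm_num) x hx hi]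
  · intro x hx hi i
    simp [key 2 (by norm_num) x hx hi]
  · intro x hx hi
    simp [oddBump, key 2 (by norm_num) x hx hi, key 1 (by norm_num) x hx hi]
  · intro x hx
    simp [oddBump, bump, sqDist_reflZero, hx]

lemma IsHarmonicZeroExt.hasCompactSupport_mul {n : ℕ} {w : (Fin (n + 1) → ℝ) → ℝ}
    (hw : IsHarmonicZeroExt w) {g : (Fin (n + 1) → ℝ) → ℝ} {s : ℝ} {y : Fin (n + 1) → ℝ}
    (hg : ∀ x, 0 ≤ x 0 → s ≤ sqDist y x → g x = 0) : HasCompactSupport fun x => w x * g x := by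
  refine HasCompactSupport.intro (K := Set.Icc (fun _ => -supportRadius s y)
    (fun _ => supportRadius s y)) isCompact_Icc fun x hx => ?_
  rcases le_total (x 0) 0 with h0 | h0
  · rw [hw.eq_zero x h0, zero_mul]
  · rw [hg x h0, mul_zero]
    by_contra hc
    refine hx ⟨fun i => ?_, fun i => ?_⟩ <;>
    · have h : ¬ supportRadius s y ≤ |x i| := fun hi => hc (le_sqDist_of_supportRadius_le hi)
      have h' := abs_lt.1 (not_le.1 h)
      linarith [h'.1, h'.2]

lemma IsHarmonicZeroExt.integrable_mul {n : ℕ} {w : (Fin (n + 1) → ℝ) → ℝ}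
    (hw : IsHarmonicZeroExt w) {g : (Fin (n + 1) → ℝ) → ℝ} (hgc : Continuous g) {s : ℝ}
    {y : Fin (n + 1) → ℝ} (hg : ∀ x, 0 ≤ x 0 → s ≤ sqDist y x → g x = 0) :
    Integrable fun x => w x * g x :=
  (hw.continuous.mul hgc).integrable_of_hasCompactSupport (hw.hasCompactSupport_mul hg)

lemma oddBump_eq_zero {n k : ℕ} (hk : k ≠ 0) {s : ℝ} {x y : Fin (n + 1) → ℝ} (hy : 0 ≤ y 0)
    (hx : 0 ≤ x 0) (h : s ≤ sqDist y x) : oddBump k s y x = 0 := by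
  rw [oddBump, bump_eq_zero hk h, bump_eq_zero hk (le_sqDist_reflZero hy hx h), sub_zero]

lemma oddBump_nonneg {n : ℕ} (k : ℕ) (s : ℝ) {x y : Fin (n + 1) → ℝ} (hy : 0 ≤ y 0)
    (hx : 0 ≤ x 0) : 0 ≤ oddBump k s y x := by
  refine sub_nonneg.2 (pow_le_pow_left₀ (le_max_right _ _) (max_le_max_right _ ?_) k)
  linarith [le_sqDist_reflZero hy hx (le_refl (sqDist y x))]

/-- The integral of `w` against `oddBump 2`. -/
def oddMoment {n : ℕ} (w : (Fin (n + 1) → ℝ) → ℝ) (y : Fin (n + 1) → ℝ) (s : ℝ) : ℝ :=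
  ∫ x, w x * oddBump 2 s y x

lemma IsHarmonicZeroExt.integrable_oddBump {n : ℕ} {w : (Fin (n + 1) → ℝ) → ℝ}
    (hw : IsHarmonicZeroExt w) {k : ℕ} (hk : k ≠ 0) {y : Fin (n + 1) → ℝ} (hy : 0 ≤ y 0) (s : ℝ) :
    Integrable fun x => w x * oddBump k s y x :=
  hw.integrable_mul (by fun_prop) fun _ hx h => oddBump_eq_zero hk hy hx h

lemma hasDerivAt_bump_two {n : ℕ} (y x : Fin (n + 1) → ℝ) (s : ℝ) :
    HasDerivAt (fun s => bump 2 s y x) (2 * bump 1 s y x) s := by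
  have h := (hasDerivAt_max_zero_pow 0 (s - sqDist y x)).comp s
    ((hasDerivAt_id s).sub_const (sqDist y x))
  simpa [bump, Function.comp_def] using h

lemma IsHarmonicZeroExt.hasDerivAt_oddMoment {n : ℕ} {w : (Fin (n + 1) → ℝ) → ℝ}
    (hw : IsHarmonicZeroExt w) {y : Fin (n + 1) → ℝ} (hy : 0 ≤ y 0) (s : ℝ) :
    HasDerivAt (oddMoment w y) (∫ x, w x * (2 * oddBump 1 s y x)) s := by
  refine (hasDerivAt_integral_of_dominated_loc_of_deriv_le (μ := volume)
    (F := fun s x => w x * oddBump 2 s y x) (F' := fun s x => w x * (2 * oddBump 1 s y x))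
    (bound := fun x => w x * (2 * bump 1 (s + 1) y x))
    (Metric.ball_mem_nhds s one_pos) ?_ (hw.integrable_oddBump two_ne_zero hy s) ?_ ?_ ?_ ?_).2
  · exact Eventually.of_forall fun s' =>
      (hw.integrable_oddBump two_ne_zero hy s').aestronglyMeasurable
  · exact (hw.continuous.mul (by fun_prop)).aestronglyMeasurable
  · refine Eventually.of_forall fun x s' hs' => ?_
    have hs : s' < s + 1 := by
      have := (abs_lt.1 (by simpa [Real.dist_eq] using hs' : |s' - s| < 1)).2
      linarith
    rcases le_total (x 0) 0 with h0 | h0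
    · simp [hw.eq_zero x h0]
    · have h1 := oddBump_nonneg 1 s' hy h0
      rw [Real.norm_of_nonneg (mul_nonneg (hw.nonneg x) (by linarith))]
      refine mul_le_mul_of_nonneg_left ?_ (hw.nonneg x)
      have h2 : bump 1 s' y x ≤ bump 1 (s + 1) y x := by
        simp only [bump, pow_one]
        exact max_le_max_right _ (by linarith)
      have h3 := bump_nonneg 1 s' (reflZero y) x
      unfold oddBump
      linarith
  · exact hw.integrable_mul (by fun_prop) fun x _ h => by
      rw [bump_eq_zero one_ne_zero h, mul_zero]
  · refine Eventually.of_forall fun x s' _ => ?_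
    have h := ((hasDerivAt_bump_two y x s').sub (hasDerivAt_bump_two (reflZero y) x s')).const_mul
      (w x)
    rw [← mul_sub] at h
    exact h

lemma IsHarmonicZeroExt.oddMoment_eq {n : ℕ} {w : (Fin (n + 1) → ℝ) → ℝ}
    (hw : IsHarmonicZeroExt w) {y : Fin (n + 1) → ℝ} (hy : 0 ≤ y 0) {s : ℝ} (hs : 0 < s) :
    oddMoment w y s = oddMoment w y 1 * s ^ (((n : ℝ) + 5) / 2) := by
  set a : ℝ := ((n : ℝ) + 5) / 2 with ha
  have hode : ∀ s, s * ∫ x, w x * (2 * oddBump 1 s y x) = a * oddMoment w y s := by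
    intro s
    have h := hw.integral_oddBump hy s
    have h1 : ∀ x, w x * (24 * s * oddBump 1 s y x - (24 + 6 * (n + 1)) * oddBump 2 s y x) =
        (12 * s) * (w x * (2 * oddBump 1 s y x)) -
          (24 + 6 * (n + 1)) * (w x * oddBump 2 s y x) := fun x => by ring
    have i1 : Integrable fun x => w x * (2 * oddBump 1 s y x) :=
      hw.integrable_mul (by fun_prop) fun x hx h => by
        rw [oddBump_eq_zero one_ne_zero hy hx h, mul_zero]
    simp only [h1] at h
    rw [integral_sub (i1.const_mul _) ((hw.integrable_oddBump two_ne_zero hy s).const_mul _),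
      integral_const_mul, integral_const_mul] at h
    rw [oddMoment, ha]
    linear_combination h / 12
  have hderiv : ∀ s ∈ Set.Ioi (0 : ℝ),
      HasDerivAt (fun s => oddMoment w y s * s ^ (-a)) 0 s := by
    intro s hs
    have h := (hw.hasDerivAt_oddMoment hy s).mul
      (Real.hasDerivAt_rpow_const (p := -a) (Or.inl (ne_of_gt hs)))
    refine h.congr_deriv ?_
    have h2 : s ^ (-a) = s * s ^ (-a - 1) := by
      rw [Real.rpow_sub_one (ne_of_gt hs)]
      field_simp [ne_of_gt (Set.mem_Ioi.1 hs)]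
    rw [h2]
    linear_combination s ^ (-a - 1) * hode s
  have hconst := isOpen_Ioi.is_const_of_deriv_eq_zero (convex_Ioi (0 : ℝ)).isPreconnected
    (fun s hs => (hderiv s hs).differentiableAt.differentiableWithinAt)
    (fun s hs => (hderiv s hs).deriv) (Set.mem_Ioi.2 hs) (Set.mem_Ioi.2 one_pos)
  simp only [Real.one_rpow, mul_one] at hconst
  rw [← hconst, mul_assoc, ← Real.rpow_add hs, neg_add_cancel, Real.rpow_zero, mul_one]

lemma fderiv_max_zero {n : ℕ} {x : Fin (n + 1) → ℝ} (hx : 0 < x 0) :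
    fderiv ℝ (fun x : Fin (n + 1) → ℝ => max (x 0) 0) x =
      (ContinuousLinearMap.proj 0 : (Fin (n + 1) → ℝ) →L[ℝ] ℝ) := by
  have h : (fun x : Fin (n + 1) → ℝ => max (x 0) 0) =ᶠ[nhds x] fun x => x 0 := by
    filter_upwards [(isOpen_lt continuous_const (continuous_apply 0)).mem_nhds hx] with z hz
    exact max_eq_left (le_of_lt hz)
  rw [h.fderiv_eq]
  exact (hasFDerivAt_apply (𝕜 := ℝ) 0 x).fderiv

lemma isHarmonicZeroExt_max {n : ℕ} :
    IsHarmonicZeroExt fun x : Fin (n + 1) → ℝ => max (x 0) 0 where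
  continuous := by fun_prop
  eq_zero x hx := max_eq_right hx
  nonneg x := le_max_right _ _
  contDiffAt x hx := by
    have h : (fun x : Fin (n + 1) → ℝ => max (x 0) 0) =ᶠ[nhds x] fun x => x 0 := by
      filter_upwards [(isOpen_lt continuous_const (continuous_apply 0)).mem_nhds hx] with z hz
      exact max_eq_left (le_of_lt hz)
    exact (contDiff_apply ℝ ℝ 0).contDiffAt.congr_of_eventuallyEq h
  laplacian_eq_zero x hx := by
    refine Finset.sum_eq_zero fun i _ => ?_
    have h : (fun z => fderiv ℝ (fun x : Fin (n + 1) → ℝ => max (x 0) 0) z (Pi.single i 1))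
        =ᶠ[nhds x] fun _ => (Pi.single i (1 : ℝ) : Fin (n + 1) → ℝ) 0 := by
      filter_upwards [(isOpen_lt continuous_const (continuous_apply 0)).mem_nhds hx] with z hz
      rw [fderiv_max_zero hz]; rfl
    rw [h.fderiv_eq]
    simp

lemma IsHarmonicZeroExt.mul_oddMoment_eq {n : ℕ} {w : (Fin (n + 1) → ℝ) → ℝ}
    (hw : IsHarmonicZeroExt w) {y : Fin (n + 1) → ℝ} (hy : 0 < y 0) :
    y 0 * oddMoment w y 1 = w y * oddMoment (fun x => max (x 0) 0) y 1 := by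
  set l : (Fin (n + 1) → ℝ) → ℝ := fun x => max (x 0) 0 with hl
  have hlh : IsHarmonicZeroExt l := isHarmonicZeroExt_max
  have hly : l y = y 0 := max_eq_left hy.le
  have hest : ∀ ε > 0, |y 0 * oddMoment w y 1 - w y * oddMoment l y 1| ≤
      ε * oddMoment l y 1 := by
    intro ε hε
    have hc : Continuous fun x => |y 0 * w x - w y * l x| :=
      ((hw.continuous.const_mul _).sub (hlh.continuous.const_mul _)).abs
    have hev : ∀ᶠ x in nhds y, |y 0 * w x - w y * l x| < ε * l x := by
      refine hc.continuousAt.eventually_lt (hlh.continuous.const_mul ε).continuousAt ?_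
      rw [hly, mul_comm, sub_self, abs_zero]
      positivity
    obtain ⟨r, hr, hball⟩ := Metric.eventually_nhds_iff.1 hev
    have hpt : ∀ x, |y 0 * w x - w y * l x| * oddBump 2 (r ^ 2) y x ≤
        ε * l x * oddBump 2 (r ^ 2) y x := by
      intro x
      rcases le_total (x 0) 0 with h0 | h0
      · simp [hw.eq_zero x h0, hlh.eq_zero x h0]
      · by_cases hx : r ^ 2 ≤ sqDist y x
        · simp [oddBump_eq_zero two_ne_zero hy.le h0 hx]
        · refine mul_le_mul_of_nonneg_right (hball ?_).le (oddBump_nonneg 2 _ hy.le h0)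
          refine (dist_pi_lt_iff hr).2 fun i => abs_lt_of_sq_lt_sq ?_ hr.le
          exact (sq_sub_le_sqDist y x i).trans_lt (not_le.1 hx)
    have i1 := hw.integrable_oddBump two_ne_zero hy.le (r ^ 2)
    have i2 := hlh.integrable_oddBump two_ne_zero hy.le (r ^ 2)
    have hs : |y 0 * oddMoment w y (r ^ 2) - w y * oddMoment l y (r ^ 2)| ≤
        ε * oddMoment l y (r ^ 2) := by
      unfold oddMoment
      rw [← integral_const_mul, ← integral_const_mul, ← integral_const_mul,
        ← integral_sub (i1.const_mul _) (i2.const_mul _), ← Real.norm_eq_abs]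
      refine norm_integral_le_of_norm_le (i2.const_mul ε) (Eventually.of_forall fun x => ?_)
      rcases le_total (x 0) 0 with h0 | h0
      · simp [hw.eq_zero x h0, hlh.eq_zero x h0]
      · rw [← mul_assoc, ← mul_assoc, ← sub_mul, norm_mul, Real.norm_eq_abs,
          Real.norm_of_nonneg (oddBump_nonneg 2 _ hy.le h0), ← mul_assoc]
        exact hpt x
    have hr2 : 0 < r ^ 2 := by positivity
    rw [hw.oddMoment_eq hy.le hr2, hlh.oddMoment_eq hy.le hr2] at hs
    have hp : 0 < (r ^ 2) ^ (((n : ℝ) + 5) / 2) := Real.rpow_pos_of_pos hr2 _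
    rw [← mul_assoc, ← mul_assoc, ← mul_assoc, ← sub_mul, abs_mul, abs_of_pos hp] at hs
    exact le_of_mul_le_mul_right hs hp
  have h0 : 0 ≤ oddMoment l y 1 := by
    refine integral_nonneg fun x => ?_
    rcases le_total (x 0) 0 with h0 | h0
    · simp [hlh.eq_zero x h0]
    · exact mul_nonneg (hlh.nonneg x) (oddBump_nonneg 2 _ hy.le h0)
  refine sub_eq_zero.1 (abs_nonpos_iff.1 (le_of_forall_pos_le_add fun ε hε => ?_))
  have h1 : 0 < oddMoment l y 1 + 1 := by linarith
  refine (hest (ε / (oddMoment l y 1 + 1)) (by positivity)).trans ?_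
  rw [zero_add, div_mul_eq_mul_div, div_le_iff₀ h1]
  nlinarith

lemma oddMoment_max_pos {n : ℕ} {y : Fin (n + 1) → ℝ} (hy : 0 < y 0) :
    0 < oddMoment (fun x => max (x 0) 0) y 1 := by
  have hlh : IsHarmonicZeroExt fun x : Fin (n + 1) → ℝ => max (x 0) 0 := isHarmonicZeroExt_max
  refine Continuous.integral_pos_of_hasCompactSupport_nonneg_nonzero (x := y) (by fun_prop)
    (hlh.hasCompactSupport_mul fun x hx h => oddBump_eq_zero two_ne_zero hy.le hx h)
    (fun x => ?_) (ne_of_gt ?_)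
  · rcases le_total (x 0) 0 with h0 | h0
    · simp [h0]
    · exact mul_nonneg (le_max_right _ _) (oddBump_nonneg 2 _ hy.le h0)
  · refine mul_pos (lt_max_of_lt_left hy) ?_
    have h1 : sqDist y y = 0 := by simp [sqDist]
    simp only [oddBump, bump, sqDist_reflZero, h1]
    have h2 : max (1 - (0 + 4 * y 0 * y 0)) 0 < 1 := max_lt (by nlinarith) one_pos
    have h3 : max (1 - 0 : ℝ) 0 = 1 := by norm_num
    rw [h3]
    nlinarith [le_max_right (1 - (0 + 4 * y 0 * y 0)) 0]

/-- Inclusion of balls, quantitatively: `R² - |x - y|² ≤ (R + B)² - |x - z|²` when `|x - y| ≤ R`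
and `|y - z| ≤ B`. -/
lemma bump_one_le_bump_one {n : ℕ} {y z : Fin (n + 1) → ℝ} {R B : ℝ} (hR : 0 ≤ R) (hB : 0 ≤ B)
    (h : sqDist z y ≤ B ^ 2) (x : Fin (n + 1) → ℝ) :
    bump 1 (R ^ 2) y x ≤ bump 1 ((R + B) ^ 2) z x := by
  rcases le_total (R ^ 2) (sqDist y x) with h1 | h1
  · rw [bump_eq_zero one_ne_zero h1]
    exact bump_nonneg _ _ _ _
  · simp only [bump, pow_one]
    refine max_le_max_right _ ?_
    have hcs : ∑ i, (x i - y i) * (y i - z i) ≤ R * B := by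
      refine (abs_le_of_sq_le_sq' ?_ (by positivity)).2
      refine (Finset.sum_mul_sq_le_sq_mul_sq _ _ _).trans ?_
      rw [mul_pow]
      exact mul_le_mul h1 h (sqDist_nonneg z y) (sq_nonneg R)
    have hexp : sqDist z x = sqDist y x + 2 * ∑ i, (x i - y i) * (y i - z i) + sqDist z y := by
      simp only [sqDist, Finset.mul_sum, ← Finset.sum_add_distrib]
      exact Finset.sum_congr rfl fun i _ => by ring
    nlinarith

lemma oddBump_mul_le {n : ℕ} {x y y' : Fin (n + 1) → ℝ} (hx : 0 ≤ x 0) (hy : 0 ≤ y 0)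
    (hy' : 0 ≤ y' 0) {R B : ℝ} (hR : 0 ≤ R) (hB : 0 ≤ B) (h : sqDist (reflZero y') y ≤ B ^ 2) :
    oddBump 2 (R ^ 2) y x * y' 0 ≤ oddBump 2 ((R + B) ^ 2) y' x * y 0 := by
  have hle := bump_one_le_bump_one hR hB h x
  have upper : oddBump 2 (R ^ 2) y x ≤ 2 * (4 * x 0 * y 0) * bump 1 (R ^ 2) y x := by
    have hh : 0 ≤ 4 * x 0 * y 0 := by positivity
    simp only [oddBump, bump, sqDist_reflZero, pow_one]
    generalize 4 * x 0 * y 0 = t at hh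
    rcases le_total (R ^ 2 - sqDist y x) 0 with h1 | h1
    · rw [max_eq_right h1, max_eq_right (by linarith)]; simp
    · rw [max_eq_left h1]
      rcases le_total (R ^ 2 - (sqDist y x + t)) 0 with h2 | h2
      · rw [max_eq_right h2]; nlinarith
      · rw [max_eq_left h2]; nlinarith
  have lower : 2 * (4 * x 0 * y' 0) * bump 1 ((R + B) ^ 2) (reflZero y') x ≤
      oddBump 2 ((R + B) ^ 2) y' x := by
    have hh : 0 ≤ 4 * x 0 * y' 0 := by positivity
    simp only [oddBump, bump, sqDist_reflZero, pow_one]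
    generalize 4 * x 0 * y' 0 = t at hh
    rcases le_total ((R + B) ^ 2 - (sqDist y' x + t)) 0 with h1 | h1
    · rw [max_eq_right h1]; simp
    · rw [max_eq_left h1, max_eq_left (by linarith)]
      nlinarith
  calc oddBump 2 (R ^ 2) y x * y' 0
      ≤ 2 * (4 * x 0 * y 0) * bump 1 (R ^ 2) y x * y' 0 := mul_le_mul_of_nonneg_right upper hy'
    _ ≤ 2 * (4 * x 0 * y 0) * bump 1 ((R + B) ^ 2) (reflZero y') x * y' 0 := by gcongr
    _ = 2 * (4 * x 0 * y' 0) * bump 1 ((R + B) ^ 2) (reflZero y') x * y 0 := by ring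
    _ ≤ oddBump 2 ((R + B) ^ 2) y' x * y 0 := mul_le_mul_of_nonneg_right lower hy

lemma IsHarmonicZeroExt.oddMoment_mul_le {n : ℕ} {w : (Fin (n + 1) → ℝ) → ℝ}
    (hw : IsHarmonicZeroExt w) {y y' : Fin (n + 1) → ℝ} (hy : 0 ≤ y 0) (hy' : 0 ≤ y' 0) :
    oddMoment w y 1 * y' 0 ≤ oddMoment w y' 1 * y 0 := by
  set a : ℝ := ((n : ℝ) + 5) / 2 with ha
  obtain ⟨B, hB, hBs⟩ : ∃ B : ℝ, 0 ≤ B ∧ sqDist (reflZero y') y ≤ B ^ 2 :=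
    ⟨√(sqDist (reflZero y') y), Real.sqrt_nonneg _, (Real.sq_sqrt (sqDist_nonneg _ _)).ge⟩
  have hR : ∀ R : ℝ, 0 < R →
      oddMoment w y 1 * y' 0 ≤ oddMoment w y' 1 * y 0 * ((1 + B * R⁻¹) ^ 2) ^ a := by
    intro R hR
    have h1 : oddMoment w y (R ^ 2) * y' 0 ≤ oddMoment w y' ((R + B) ^ 2) * y 0 := by
      unfold oddMoment
      rw [← integral_mul_const, ← integral_mul_const]
      refine integral_mono ((hw.integrable_oddBump two_ne_zero hy _).mul_const _)
        ((hw.integrable_oddBump two_ne_zero hy' _).mul_const _) fun x => ?_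
      rcases le_total (x 0) 0 with h0 | h0
      · simp [hw.eq_zero x h0]
      · simp only [mul_assoc]
        exact mul_le_mul_of_nonneg_left (oddBump_mul_le h0 hy hy' hR.le hB hBs) (hw.nonneg x)
    have hRB : (R + B) ^ 2 = (1 + B * R⁻¹) ^ 2 * R ^ 2 := by
      field_simp
    rw [hw.oddMoment_eq hy (by positivity), hw.oddMoment_eq hy' (by positivity), hRB,
      Real.mul_rpow (by positivity) (by positivity)] at h1
    have hp : 0 < (R ^ 2) ^ a := Real.rpow_pos_of_pos (by positivity) _
    refine le_of_mul_le_mul_right ?_ hp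
    calc _ = _ := by ring
      _ ≤ _ := h1
      _ = _ := by ring
  have hlim : Tendsto (fun R : ℝ => oddMoment w y' 1 * y 0 * ((1 + B * R⁻¹) ^ 2) ^ a) atTop
      (nhds (oddMoment w y' 1 * y 0 * ((1 + B * 0) ^ 2) ^ a)) := by
    have h1 : Tendsto (fun R : ℝ => (1 + B * R⁻¹) ^ 2) atTop (nhds ((1 + B * 0) ^ 2)) :=
      ((tendsto_inv_atTop_zero.const_mul B).const_add 1).pow 2
    exact (h1.rpow_const (Or.inl (by norm_num))).const_mul _
  have := ge_of_tendsto hlim (by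
    filter_upwards [eventually_gt_atTop 0] with R h using hR R h)
  simpa using this

/-- A nonnegative harmonic function on the half-space vanishing on the boundary is a multiple of
the first coordinate. -/
theorem IsHarmonicZeroExt.mul_eq_mul {n : ℕ} {w : (Fin (n + 1) → ℝ) → ℝ}
    (hw : IsHarmonicZeroExt w) {y y' : Fin (n + 1) → ℝ} (hy : 0 < y 0) (hy' : 0 < y' 0) :
    w y * y' 0 = w y' * y 0 := by
  have hlh : IsHarmonicZeroExt fun x : Fin (n + 1) → ℝ => max (x 0) 0 := isHarmonicZeroExt_max
  have e1 := le_antisymm (hw.oddMoment_mul_le hy.le hy'.le) (hw.oddMoment_mul_le hy'.le hy.le)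
  have e2 := le_antisymm (hlh.oddMoment_mul_le hy.le hy'.le) (hlh.oddMoment_mul_le hy'.le hy.le)
  have e3 := hw.mul_oddMoment_eq hy
  have e4 := hw.mul_oddMoment_eq hy'
  have hpos := oddMoment_max_pos hy'
  refine mul_right_cancel₀ (mul_pos hpos hy).ne' ?_
  linear_combination (-y' 0 * w y) * e2 - (y' 0 * y' 0) * e3 + (y 0 * y' 0) * e1 +
    (y 0 * y 0) * e4

lemma mem_closure_halfSpace {d : ℕ} {z : EuclideanSpace ℝ (Fin (d + 2))} (hz : 0 ≤ z 0) :
    z ∈ closure (HalfSpace d) := by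
  have hc : Continuous fun t : ℝ => z + t • EuclideanSpace.single (0 : Fin (d + 2)) (1 : ℝ) := by
    fun_prop
  have hlim : Tendsto (fun t : ℝ => z + t • EuclideanSpace.single (0 : Fin (d + 2)) (1 : ℝ))
      (nhdsWithin 0 (Set.Ioi 0)) (nhds z) := by
    simpa using (hc.tendsto 0).mono_left nhdsWithin_le_nhds
  refine mem_closure_of_tendsto hlim ?_
  filter_upwards [self_mem_nhdsWithin] with t ht
  have ht' : 0 < t := ht
  simp only [HalfSpace, Set.mem_ofPred_eq, PiLp.add_apply, PiLp.smul_apply,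
    PiLp.single_apply, if_true, smul_eq_mul, mul_one]
  linarith

/-- The coordinate isomorphism onto Euclidean space. -/
def toEuclid (d : ℕ) : (Fin (d + 2) → ℝ) ≃L[ℝ] EuclideanSpace ℝ (Fin (d + 2)) :=
  (EuclideanSpace.equiv (Fin (d + 2)) ℝ).symm

lemma toEuclid_apply {d : ℕ} (x : Fin (d + 2) → ℝ) (i : Fin (d + 2)) : toEuclid d x i = x i := rfl

lemma toEuclid_single {d : ℕ} (i : Fin (d + 2)) :
    toEuclid d (Pi.single i 1) = EuclideanSpace.single i 1 := rfl

/-- The extension by zero of a function on the closed half-space, in coordinates. -/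
def zeroExt {d : ℕ} (v : EuclideanSpace ℝ (Fin (d + 2)) → ℝ) (x : Fin (d + 2) → ℝ) : ℝ :=
  v (toEuclid d (Function.update x 0 (max (x 0) 0)))

lemma zeroExt_apply {d : ℕ} (v : EuclideanSpace ℝ (Fin (d + 2)) → ℝ) {x : Fin (d + 2) → ℝ}
    (hx : 0 ≤ x 0) : zeroExt v x = v (toEuclid d x) := by
  rw [zeroExt, max_eq_left hx, Function.update_eq_self]

lemma zeroExt_eventuallyEq {d : ℕ} (v : EuclideanSpace ℝ (Fin (d + 2)) → ℝ) {x : Fin (d + 2) → ℝ}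
    (hx : 0 < x 0) : zeroExt v =ᶠ[nhds x] v ∘ toEuclid d := by
  filter_upwards [(isOpen_lt continuous_const (continuous_apply 0)).mem_nhds hx] with z hz
  exact zeroExt_apply v (le_of_lt hz)

lemma IsPosSolHS.isHarmonicZeroExt {d : ℕ} {v : EuclideanSpace ℝ (Fin (d + 2)) → ℝ}
    (hv : IsPosSolHS v) : IsHarmonicZeroExt (zeroExt v) := by
  obtain ⟨hcont, hsmooth, hharm, hpos, hzero⟩ := hv
  have hopen : IsOpen (HalfSpace d) :=
    isOpen_lt continuous_const (PiLp.continuous_apply 2 _ 0)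
  have heq0 : ∀ x : Fin (d + 2) → ℝ, x 0 ≤ 0 → zeroExt v x = 0 := fun x hx =>
    hzero _ (by rw [toEuclid_apply, Function.update_self, max_eq_right hx])
  refine ⟨?_, heq0, ?_, ?_, ?_⟩
  · refine hcont.comp_continuous
      ((toEuclid d).continuous.comp (continuous_id.update 0 (by fun_prop))) fun x => ?_
    refine mem_closure_halfSpace ?_
    rw [toEuclid_apply, Function.update_self]
    exact le_max_right _ _
  · intro x
    rcases le_or_gt (x 0) 0 with h | h
    · exact (heq0 x h).ge
    · rw [zeroExt_apply v h.le]
      exact (hpos _ h).le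
  · intro x hx
    refine ContDiffAt.congr_of_eventuallyEq ?_ (zeroExt_eventuallyEq v hx)
    exact (hsmooth.contDiffAt (hopen.mem_nhds (show toEuclid d x ∈ HalfSpace d from hx))).comp x
      (toEuclid d).contDiff.contDiffAt
  · intro x hx
    have hfirst : ∀ i, (fun z => fderiv ℝ (zeroExt v) z (Pi.single i 1)) =ᶠ[nhds x]
        (fun z' => fderiv ℝ v z' (EuclideanSpace.single i 1)) ∘ toEuclid d := by
      intro i
      filter_upwards [(isOpen_lt continuous_const (continuous_apply 0)).mem_nhds hx] with z hz
      rw [(zeroExt_eventuallyEq v hz).fderiv_eq, ContinuousLinearEquiv.comp_right_fderiv]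
      rfl
    rw [← hharm (toEuclid d x) hx, lapE]
    refine Finset.sum_congr rfl fun i _ => ?_
    rw [(hfirst i).fderiv_eq, ContinuousLinearEquiv.comp_right_fderiv]
    rfl

/-- Positive solutions on the half-space are positive multiples of the first coordinate. -/
theorem IsPosSolHS.exists_eq_mul {d : ℕ} {v : EuclideanSpace ℝ (Fin (d + 2)) → ℝ}
    (hv : IsPosSolHS v) : ∃ c : ℝ, 0 < c ∧ ∀ z, 0 ≤ z 0 → v z = c * z 0 := by
  have hw := hv.isHarmonicZeroExt
  have he : 0 < (Pi.single 0 1 : Fin (d + 2) → ℝ) 0 := by simp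
  refine ⟨v (toEuclid d (Pi.single 0 1)), hv.2.2.2.1 _ he, fun z hz => ?_⟩
  rcases hz.eq_or_lt with h | h
  · rw [hv.2.2.2.2 z h.symm, ← h, mul_zero]
  · have hz' : 0 < ((toEuclid d).symm z) 0 := h
    have key := hw.mul_eq_mul hz' he
    rw [zeroExt_apply v hz'.le, zeroExt_apply v he.le, ContinuousLinearEquiv.apply_symm_apply,
      Pi.single_eq_same, mul_one] at key
    exact key

lemma lapE_const_mul_apply {d : ℕ} (c : ℝ) (z : EuclideanSpace ℝ (Fin (d + 2))) :
    lapE (fun z' => c * z' 0) z = 0 := by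
  have h : ∀ z, fderiv ℝ (fun z' : EuclideanSpace ℝ (Fin (d + 2)) => c * z' 0) z =
      c • EuclideanSpace.proj 0 := fun z =>
    ((EuclideanSpace.proj (𝕜 := ℝ) (0 : Fin (d + 2))).hasFDerivAt.const_mul c).fderiv
  simp [lapE, h]

/-- Any positive solution `v` on the half-space is asymptotic, uniformly
on the closed upper unit hemisphere, to `r^N̄ φ(θ)`, where `φ` is continuous on the closed
upper hemisphere, vanishes on the equator, is positive on the open hemisphere, and the
positively homogeneous function `z ↦ |z|^N̄ φ(z/|z|)` is harmonic on `H` (equivalently,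
`N̄(N̄-1) + N̄(N-1)` is a Dirichlet eigenvalue of the spherical Laplacian on the hemisphere
with eigenfunction `φ`). -/
theorem statement13 {d : ℕ} (v : EuclideanSpace ℝ (Fin (d+2)) → ℝ)
    (hv : IsPosSolHS v) :
    ∃ Nbar : ℝ, 0 < Nbar ∧ ∃ φ : EuclideanSpace ℝ (Fin (d+2)) → ℝ,
      ContinuousOn φ {θ : EuclideanSpace ℝ (Fin (d+2)) | ‖θ‖ = 1 ∧ 0 ≤ θ 0} ∧
      (∀ θ : EuclideanSpace ℝ (Fin (d+2)), ‖θ‖ = 1 → θ 0 = 0 → φ θ = 0) ∧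
      (∀ θ : EuclideanSpace ℝ (Fin (d+2)), ‖θ‖ = 1 → 0 < θ 0 → 0 < φ θ) ∧
      (∀ z ∈ HalfSpace d, lapE (fun z' => ‖z'‖ ^ Nbar * φ (‖z'‖⁻¹ • z')) z = 0) ∧
      (∀ ε : ℝ, 0 < ε → ∃ R : ℝ, ∀ r ≥ R, ∀ θ : EuclideanSpace ℝ (Fin (d+2)),
        ‖θ‖ = 1 → 0 ≤ θ 0 → |r ^ (-Nbar) * v (r • θ) - φ θ| < ε) := by
  obtain ⟨c, hc, hvc⟩ := hv.exists_eq_mul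
  refine ⟨1, one_pos, fun z => c * z 0, by fun_prop, fun θ _ h => by simp [h],
    fun θ _ h => mul_pos hc h, fun z _ => ?_, fun ε hε => ⟨1, fun r hr θ _ h => ?_⟩⟩
  · have h : (fun z' : EuclideanSpace ℝ (Fin (d + 2)) =>
        ‖z'‖ ^ (1 : ℝ) * (c * (‖z'‖⁻¹ • z') 0)) = fun z' => c * z' 0 := by
      ext z'
      rcases eq_or_ne z' 0 with h0 | h0
      · simp [h0]
      · have hn : ‖z'‖ ≠ 0 := norm_ne_zero_iff.2 h0
        rw [Real.rpow_one, PiLp.smul_apply, smul_eq_mul]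
        field_simp
    rw [h]
    exact lapE_const_mul_apply c z
  · have hr0 : 0 < r := by linarith
    rw [hvc _ (by simpa using mul_nonneg hr0.le h), PiLp.smul_apply, smul_eq_mul,
      Real.rpow_neg_one, show r⁻¹ * (c * (r * θ 0)) - c * θ 0 = 0 by field_simp; ring, abs_zero]
    exact hε
end
end
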